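/- arXiv:2603.23305 — 4 statements merged into one kernel-verified Lean document; each statement's English description precedes it below -/
import Mathlib

section
/- (Lower bound on the expected log-partition function.) In the Gaussian contextual graph matching model with π* = id, if d = ω((log n)²) and ρ²n/(1−ρ²) + 2η²d/(1−η²) ≤ 2(1−ε) log n for some ε > 0, then E[log Z] ≥ ((1+ε)/2) n log n (1+o(1)) as n → ∞. -/
open MeasureTheory ProbabilityTheory Real Filter Finset Topology

noncomputable section

namespace CGM

/-- array of (potential) edge weights of a graph on `n` vertices -/
abbrev GW (n : ℕ) := Fin n → Fin n → ℝ

/-- array of feature values: `n` users, `d` features each -/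
abbrev FW (n d : ℕ) := Fin n → Fin d → ℝ

/-- latent sample space: (graph weights, graph noise, features, feature noise) -/
abbrev Samp (n d : ℕ) := (GW n × GW n) × (FW n d × FW n d)

/-- i.i.d. standard Gaussian array (graph part) -/
def stdGaussG (n : ℕ) : Measure (GW n) :=
  Measure.pi fun _ => Measure.pi fun _ => gaussianReal 0 1

/-- i.i.d. standard Gaussian array (feature part) -/
def stdGaussF (n d : ℕ) : Measure (FW n d) :=
  Measure.pi fun _ => Measure.pi fun _ => gaussianReal 0 1

/-- law of the latent randomness of the model -/
def μ (n d : ℕ) : Measure (Samp n d) :=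
  ((stdGaussG n).prod (stdGaussG n)).prod ((stdGaussF n d).prod (stdGaussF n d))

/-- symmetrization of an array, so that only the upper-triangular part matters -/
def sym {n : ℕ} (f : GW n) : GW n := fun i j => if i ≤ j then f i j else f j i

variable {n d : ℕ}

/-- the weighted adjacency matrix `A` -/
def Amat (ω : Samp n d) : GW n := sym ω.1.1

/-- the weighted adjacency matrix `B` (before relabeling by `π*`, i.e. conditionally
on `π* = id`): each pair `(A i j, B i j)`, `i < j`, is bivariate centered Gaussian
with unit variances and correlation `ρ`. -/
def Bmat (ρ : ℝ) (ω : Samp n d) : GW n :=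
  fun i j => ρ * Amat ω i j + Real.sqrt (1 - ρ ^ 2) * sym ω.1.2 i j

/-- the feature matrix `X` -/
def Xmat (ω : Samp n d) : FW n d := ω.2.1

/-- the feature matrix `Y` (conditionally on `π* = id`): each pair `(X i j, Y i j)` is
bivariate centered Gaussian with unit variances and correlation `η`. -/
def Ymat (η : ℝ) (ω : Samp n d) : FW n d :=
  fun i j => η * ω.2.1 i j + Real.sqrt (1 - η ^ 2) * ω.2.2 i j

/-- the ordered pairs `i < j` whose unordered pair `{i,j}` is moved by `φ`;
its cardinality is `|D^E_φ|`. -/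
def movedEdges (φ : Equiv.Perm (Fin n)) : Finset (Fin n × Fin n) :=
  Finset.univ.filter fun p =>
    p.1 < p.2 ∧ ¬((φ p.1 = p.1 ∧ φ p.2 = p.2) ∨ (φ p.1 = p.2 ∧ φ p.2 = p.1))

/-- `V*_G(φ) = Σ_{{i,j} ∈ D^E_φ} B_{ij} A_{ij}` -/
def VGstar (ρ : ℝ) (φ : Equiv.Perm (Fin n)) (ω : Samp n d) : ℝ :=
  ∑ p ∈ movedEdges φ, Bmat ρ ω p.1 p.2 * Amat ω p.1 p.2

/-- `V_G(φ) = Σ_{{i,j} ∈ D^E_φ} B_{φ(i,j)} A_{ij}` -/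
def VG (ρ : ℝ) (φ : Equiv.Perm (Fin n)) (ω : Samp n d) : ℝ :=
  ∑ p ∈ movedEdges φ, Bmat ρ ω (φ p.1) (φ p.2) * Amat ω p.1 p.2

/-- `V*_F(φ) = Σ_{i ∈ D_φ, j ≤ d} Y_{ij} X_{ij}` -/
def VFstar (η : ℝ) (φ : Equiv.Perm (Fin n)) (ω : Samp n d) : ℝ :=
  ∑ i ∈ φ.support, ∑ j, Ymat η ω i j * Xmat ω i j

/-- `V_F(φ) = Σ_{i ∈ D_φ, j ≤ d} Y_{φ(i),j} X_{ij}` -/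
def VF (η : ℝ) (φ : Equiv.Perm (Fin n)) (ω : Samp n d) : ℝ :=
  ∑ i ∈ φ.support, ∑ j, Ymat η ω (φ i) j * Xmat ω i j

/-- the Hamiltonian `V(φ)` -/
def V (ρ η : ℝ) (φ : Equiv.Perm (Fin n)) (ω : Samp n d) : ℝ :=
  ρ / (1 - ρ ^ 2) * (VGstar ρ φ ω - VG ρ φ ω)
    + η / (1 - η ^ 2) * (VFstar η φ ω - VF η φ ω)

/-- the partition function `Z = Σ_φ exp(−V(φ))` -/
def Zpart (ρ η : ℝ) (ω : Samp n d) : ℝ :=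
  ∑ φ : Equiv.Perm (Fin n), Real.exp (-(V ρ η φ ω))

end CGM

namespace CGM

/-- The standard Gaussian measure on `ι → ℝ`. -/
def stdGauss (ι : Type*) [Fintype ι] : Measure (ι → ℝ) :=
  Measure.pi fun _ => gaussianReal 0 1

section GaussianIntegrals

variable {ι : Type*} [Fintype ι]

instance : IsProbabilityMeasure (stdGauss ι) := by
  unfold stdGauss; infer_instance

lemma integral_exp_mul_gaussianReal (t : ℝ) :
    ∫ x, exp (t * x) ∂gaussianReal 0 1 = exp (t ^ 2 / 2) := by
  have h := congrFun (mgf_fun_id_gaussianReal (μ := 0) (v := 1)) t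
  simpa [mgf] using h

lemma integrable_exp_linear (c : ι → ℝ) :
    Integrable (fun x => exp (∑ e, c e * x e)) (stdGauss ι) := by
  simp_rw [exp_sum]
  exact Integrable.fintype_prod (f := fun e x => exp (c e * x))
    fun e => integrable_exp_mul_gaussianReal (c e)

lemma integral_exp_linear (c : ι → ℝ) :
    ∫ x, exp (∑ e, c e * x e) ∂stdGauss ι = exp ((∑ e, c e ^ 2) / 2) := by
  simp_rw [exp_sum]
  rw [stdGauss, integral_fintype_prod_eq_prod (f := fun e x => exp (c e * x))]
  simp_rw [integral_exp_mul_gaussianReal]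
  rw [← exp_sum, Finset.sum_div]

lemma integrable_exp_mul_sq_gaussianReal {l : ℝ} (hl : l < 1 / 2) :
    Integrable (fun x => exp (l * x ^ 2)) (gaussianReal 0 1) := by
  rw [gaussianReal_of_var_ne_zero _ one_ne_zero, integrable_withDensity_iff_integrable_smul₀'
    (by fun_prop) (by simp [gaussianPDF_lt_top])]
  have h : Integrable fun x : ℝ => (√(2 * π))⁻¹ * exp (-(1 / 2 - l) * x ^ 2) :=
    (integrable_exp_neg_mul_sq (by linarith)).const_mul _
  refine h.congr (ae_of_all _ fun x => ?_)
  simp only [toReal_gaussianPDF, gaussianPDFReal, smul_eq_mul]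
  rw [mul_assoc, ← exp_add]
  simp only [NNReal.coe_one, mul_one, sub_zero]
  congr 2
  ring

lemma integral_exp_mul_sq_gaussianReal {l : ℝ} (hl : l < 1 / 2) :
    ∫ x, exp (l * x ^ 2) ∂gaussianReal 0 1 = (√(1 - 2 * l))⁻¹ := by
  rw [integral_gaussianReal_eq_integral_smul one_ne_zero]
  have h : ∀ x : ℝ, gaussianPDFReal 0 1 x • exp (l * x ^ 2)
      = (√(2 * π))⁻¹ * exp (-(1 / 2 - l) * x ^ 2) := by
    intro x
    simp only [gaussianPDFReal, smul_eq_mul]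
    rw [mul_assoc, ← exp_add]
    simp only [NNReal.coe_one, mul_one, sub_zero]
    congr 2
    ring
  simp_rw [h]
  rw [integral_const_mul, integral_gaussian, ← sqrt_inv, ← sqrt_inv, ← sqrt_mul (by positivity)]
  congr 1
  have : 1 - 2 * l ≠ 0 := by linarith
  have : 1 / 2 - l ≠ 0 := by linarith
  field_simp

lemma inv_sqrt_le_exp {l : ℝ} (h0 : 0 ≤ l) (hl : l ≤ 1 / 4) :
    (√(1 - 2 * l))⁻¹ ≤ exp (2 * l) := by
  have h1 : exp (-(4 * l)) ≤ 1 - 2 * l := by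
    have h2 : 1 + 4 * l ≤ exp (4 * l) := by linarith [add_one_le_exp (4 * l)]
    rw [exp_neg]
    refine inv_le_of_inv_le₀ (by linarith) (le_trans ?_ h2)
    rw [inv_le_iff_one_le_mul₀ (by linarith)]
    nlinarith
  have h3 : exp (-(2 * l)) ≤ √(1 - 2 * l) := by
    refine le_sqrt_of_sq_le ?_
    rw [← exp_nat_mul]
    convert h1 using 2
    push_cast
    ring
  calc (√(1 - 2 * l))⁻¹ ≤ (exp (-(2 * l)))⁻¹ := inv_anti₀ (exp_pos _) h3
    _ = exp (2 * l) := by rw [← exp_neg, neg_neg]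

lemma integrable_exp_quadratic {c : ι → ℝ} (hc : ∀ e, c e < 1 / 2) :
    Integrable (fun x => exp (∑ e, c e * x e ^ 2)) (stdGauss ι) := by
  simp_rw [exp_sum]
  exact Integrable.fintype_prod (f := fun e x => exp (c e * x ^ 2))
    fun e => integrable_exp_mul_sq_gaussianReal (hc e)

lemma integral_exp_quadratic_le {c : ι → ℝ} (h0 : ∀ e, 0 ≤ c e) (hc : ∀ e, c e ≤ 1 / 4) :
    ∫ x, exp (∑ e, c e * x e ^ 2) ∂stdGauss ι ≤ exp (2 * ∑ e, c e) := by
  simp_rw [exp_sum]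
  rw [stdGauss, integral_fintype_prod_eq_prod (f := fun e x => exp (c e * x ^ 2)), Finset.mul_sum,
    exp_sum]
  refine Finset.prod_le_prod (fun e _ => integral_nonneg fun x => (exp_pos _).le) fun e _ => ?_
  rw [integral_exp_mul_sq_gaussianReal (by linarith [hc e])]
  exact inv_sqrt_le_exp (h0 e) (hc e)

lemma memLp_eval (e : ι) : MemLp (fun x : ι → ℝ => x e) 2 (stdGauss ι) :=
  (memLp_id_gaussianReal' 2 (by simp)).comp_measurePreserving
    (measurePreserving_eval (fun _ => gaussianReal 0 1) e)

lemma integrable_eval (e : ι) : Integrable (fun x : ι → ℝ => x e) (stdGauss ι) :=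
  (memLp_eval e).integrable (by norm_num)

lemma integrable_eval_mul (e f : ι) :
    Integrable (fun x : ι → ℝ => x e * x f) (stdGauss ι) :=
  (memLp_eval e).integrable_mul (memLp_eval f)

lemma integral_eval (e : ι) : ∫ x, x e ∂stdGauss ι = 0 := by
  have h := integral_comp_eval (μ := fun _ : ι => gaussianReal 0 1) (i := e) (f := fun x : ℝ => x)
    (by fun_prop)
  rw [stdGauss, h]
  exact integral_id_gaussianReal

lemma integral_eval_sq (e : ι) : ∫ x, x e ^ 2 ∂stdGauss ι = 1 := by
  have h := integral_comp_eval (μ := fun _ : ι => gaussianReal 0 1) (i := e)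
    (f := fun x : ℝ => x ^ 2) (by fun_prop)
  rw [stdGauss, h]
  have := variance_fun_id_gaussianReal (μ := 0) (v := 1)
  rw [variance_eq_integral (by fun_prop)] at this
  simpa using this

lemma integral_eval_mul [DecidableEq ι] (e f : ι) :
    ∫ x, x e * x f ∂stdGauss ι = if e = f then 1 else 0 := by
  split_ifs with h
  · subst h
    simpa [sq] using integral_eval_sq e
  · have hi : iIndepFun (fun i (x : ι → ℝ) => x i) (stdGauss ι) :=
      iIndepFun_pi (X := fun _ x => x) (fun _ => by fun_prop)
    have := (hi.indepFun h).integral_mul_eq_mul_integral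
      (integrable_eval e).aestronglyMeasurable (integrable_eval f).aestronglyMeasurable
    simpa [integral_eval] using this

lemma measurePreserving_comp_equiv {κ : Type*} [Fintype κ] (σ : ι ≃ κ) :
    MeasurePreserving (fun (x : κ → ℝ) e => x (σ e)) (stdGauss κ) (stdGauss ι) := by
  refine ⟨by fun_prop, (Measure.pi_eq fun s hs => ?_).symm⟩
  have hpre : (fun (x : κ → ℝ) e => x (σ e)) ⁻¹' Set.univ.pi s
      = Set.univ.pi fun e => s (σ.symm e) := by
    ext x
    simp only [Set.mem_preimage, Set.mem_pi, Set.mem_univ, true_implies]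
    exact ⟨fun h e => by simpa using h (σ.symm e), fun h e => by simpa using h (σ e)⟩
  rw [Measure.map_apply (by fun_prop) (MeasurableSet.univ_pi hs), hpre, stdGauss, Measure.pi_pi]
  exact Equiv.prod_comp σ.symm fun e => gaussianReal 0 1 (s e)

instance : IsGaussian (stdGauss ι) := by
  have hi : iIndepFun (fun i (x : ι → ℝ) => x i) (stdGauss ι) :=
    iIndepFun_pi (X := fun _ x => x) (fun _ => by fun_prop)
  have h := hi.hasGaussianLaw fun i => ⟨by
    have : (stdGauss ι).map (fun x => x i) = gaussianReal 0 1 :=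
      (measurePreserving_eval (fun _ => gaussianReal 0 1) i).map_eq
    rw [this]
    infer_instance⟩
  simpa using h.isGaussian_map

lemma measurePreserving_rotation :
    MeasurePreserving (fun p : (ι → ℝ) × (ι → ℝ) =>
      ((fun e => (p.1 e + p.2 e) / √2, fun e => (p.2 e - p.1 e) / √2) : (ι → ℝ) × (ι → ℝ)))
      ((stdGauss ι).prod (stdGauss ι)) ((stdGauss ι).prod (stdGauss ι)) := by
  refine ⟨by fun_prop, ?_⟩
  have h0 : (stdGauss ι)[id] = 0 := by
    ext e
    simp only [id]
    rw [eval_integral fun e => integrable_eval e]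
    exact integral_eval e
  conv_rhs => rw [← IsGaussian.map_rotation_eq_self h0 (π / 4)]
  congr 1
  funext p
  rw [ContinuousLinearMap.rotation_apply, cos_pi_div_four, sin_pi_div_four]
  have h2 : √2 / 2 = 1 / √2 := by
    rw [div_eq_div_iff (by norm_num) (by positivity)]
    norm_num
  ext e
  · simp only [h2, Pi.add_apply, Pi.smul_apply, smul_eq_mul]
    ring
  · simp only [h2, Pi.add_apply, Pi.smul_apply, smul_eq_mul]
    ring

end GaussianIntegrals

lemma exp_integral_le {Ω : Type*} [MeasurableSpace Ω] {P : Measure Ω} [IsProbabilityMeasure P]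
    {f : Ω → ℝ} (hf : Integrable f P) (he : Integrable (fun ω => exp (f ω)) P) :
    exp (∫ ω, f ω ∂P) ≤ ∫ ω, exp (f ω) ∂P :=
  convexOn_exp.map_integral_le continuous_exp.continuousOn isClosed_univ (by simp) hf he

section Chaos

variable {ι : Type*} [Fintype ι]

lemma abs_chaos_le {σ : Equiv.Perm ι} {θ : ι → ℝ} (hσ : ∀ e, θ (σ e) = θ e) (h0 : ∀ e, 0 ≤ θ e)
    (x : ι → ℝ) : |∑ e, θ e * (x e * x (σ e))| ≤ ∑ e, θ e * x e ^ 2 := by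
  have h1 : ∑ e, θ e * x (σ e) ^ 2 = ∑ e, θ e * x e ^ 2 := by
    rw [← Equiv.sum_comp σ fun e => θ e * x e ^ 2]
    simp_rw [hσ]
  calc |∑ e, θ e * (x e * x (σ e))| ≤ ∑ e, |θ e * (x e * x (σ e))| := abs_sum_le_sum_abs _ _
    _ ≤ ∑ e, (θ e * x e ^ 2 + θ e * x (σ e) ^ 2) / 2 := by
        refine Finset.sum_le_sum fun e _ => ?_
        rw [abs_mul, abs_of_nonneg (h0 e), abs_mul, ← sq_abs (x e), ← sq_abs (x (σ e))]
        nlinarith [mul_nonneg (h0 e) (sq_nonneg (|x e| - |x (σ e)|))]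
    _ = ∑ e, θ e * x e ^ 2 := by
        rw [← Finset.sum_div, Finset.sum_add_distrib, h1]
        ring

lemma integrable_exp_chaos {σ : Equiv.Perm ι} {θ : ι → ℝ} (hσ : ∀ e, θ (σ e) = θ e)
    (h0 : ∀ e, 0 ≤ θ e) (h1 : ∀ e, θ e ≤ 1 / 4) :
    Integrable (fun x : ι → ℝ => exp (∑ e, θ e * (x e * x (σ e)))) (stdGauss ι) := by
  refine (integrable_exp_quadratic (c := θ) fun e => by linarith [h1 e]).mono' (by fun_prop)
    (ae_of_all _ fun x => ?_)
  rw [norm_eq_abs, abs_exp]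
  exact exp_le_exp.2 ((le_abs_self _).trans (abs_chaos_le hσ h0 x))

lemma integrable_exp_neg_chaos {σ : Equiv.Perm ι} {θ : ι → ℝ} (hσ : ∀ e, θ (σ e) = θ e)
    (h0 : ∀ e, 0 ≤ θ e) (h1 : ∀ e, θ e ≤ 1 / 4) :
    Integrable (fun x : ι → ℝ => exp (-∑ e, θ e * (x e * x (σ e)))) (stdGauss ι) := by
  refine (integrable_exp_quadratic (c := θ) fun e => by linarith [h1 e]).mono' (by fun_prop)
    (ae_of_all _ fun x => ?_)
  rw [norm_eq_abs, abs_exp]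
  exact exp_le_exp.2 ((neg_le_abs _).trans (abs_chaos_le hσ h0 x))

lemma integral_chaos [DecidableEq ι] (σ : Equiv.Perm ι) (θ : ι → ℝ) :
    ∫ x, ∑ e, θ e * (x e * x (σ e)) ∂stdGauss ι = ∑ e with σ e = e, θ e := by
  rw [integral_finsetSum _ fun e _ => (integrable_eval_mul e (σ e)).const_mul _]
  simp_rw [integral_const_mul, integral_eval_mul]
  rw [Finset.sum_filter]
  refine Finset.sum_congr rfl fun e _ => ?_
  simp [eq_comm]

lemma integrable_chaos (σ : Equiv.Perm ι) (θ : ι → ℝ) :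
    Integrable (fun x => ∑ e, θ e * (x e * x (σ e))) (stdGauss ι) :=
  integrable_finsetSum _ fun e _ => (integrable_eval_mul e (σ e)).const_mul _

lemma chaos_rotation {σ : Equiv.Perm ι} {θ : ι → ℝ} (hσ : ∀ e, θ (σ e) = θ e) (x y : ι → ℝ) :
    ∑ e, θ e * ((x e + y e) / √2 * ((x (σ e) + y (σ e)) / √2))
      - ∑ e, θ e * ((y e - x e) / √2 * ((y (σ e) - x (σ e)) / √2))
      = ∑ e, θ e * (x (σ.symm e) + x (σ e)) * y e := by
  have h1 : ∑ e, θ e * x (σ.symm e) * y e = ∑ e, θ e * x e * y (σ e) := by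
    rw [← Equiv.sum_comp σ fun e => θ e * x (σ.symm e) * y e]
    simp [hσ]
  have h2 : ∑ e, θ e * (x (σ.symm e) + x (σ e)) * y e
      = ∑ e, θ e * x (σ.symm e) * y e + ∑ e, θ e * x (σ e) * y e := by
    rw [← Finset.sum_add_distrib]
    exact Finset.sum_congr rfl fun e _ => by ring
  rw [h2, h1, ← Finset.sum_add_distrib, ← Finset.sum_sub_distrib]
  refine Finset.sum_congr rfl fun e _ => ?_
  have h3 : √2 * √2 = 2 := mul_self_sqrt (by norm_num)
  rw [div_mul_div_comm, div_mul_div_comm, h3]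
  ring

/-- A Gaussian chaos `∑ θ e * x e * x (σ e)` has an exponential moment governed by the fixed points
of the permutation `σ`. -/
lemma integral_exp_chaos_le [DecidableEq ι] {σ : Equiv.Perm ι} {θ : ι → ℝ} (hσ : ∀ e, θ (σ e) = θ e)
    (h0 : ∀ e, 0 ≤ θ e) (h1 : ∀ e, θ e ≤ 1 / 4) :
    ∫ x, exp (∑ e, θ e * (x e * x (σ e))) ∂stdGauss ι
      ≤ exp (∑ e with σ e = e, θ e + 4 * ∑ e, θ e ^ 2) := by
  set q : (ι → ℝ) → ℝ := fun x => ∑ e, θ e * (x e * x (σ e)) with hq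
  have hqc : Continuous q := by fun_prop
  have hi1 : Integrable (fun x => exp (q x)) (stdGauss ι) := integrable_exp_chaos hσ h0 h1
  have hi2 : Integrable (fun x => exp (-q x)) (stdGauss ι) := integrable_exp_neg_chaos hσ h0 h1
  have hsq : ∀ e, 2 * θ e ^ 2 ≤ 1 / 4 := fun e => by nlinarith [h0 e, h1 e]
  have hlow : exp (-∑ e with σ e = e, θ e) ≤ ∫ x, exp (-q x) ∂stdGauss ι := by
    have h := exp_integral_le (integrable_chaos σ θ).neg hi2
    simp only [Pi.neg_apply] at h
    rwa [integral_neg, integral_chaos] at h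
  have hrot := measurePreserving_rotation (ι := ι)
  have hprod : Integrable (fun p : (ι → ℝ) × (ι → ℝ) => exp (q p.1) * exp (-q p.2))
      ((stdGauss ι).prod (stdGauss ι)) := hi1.mul_prod hi2
  have hcomp := hrot.integrable_comp_of_integrable hprod
  have hmul : (∫ x, exp (q x) ∂stdGauss ι) * ∫ x, exp (-q x) ∂stdGauss ι
      = ∫ x, ∫ y, exp (∑ e, θ e * (x (σ.symm e) + x (σ e)) * y e) ∂stdGauss ι ∂stdGauss ι := by
    rw [← integral_prod_mul, ← hrot.map_eq, integral_map hrot.aemeasurable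
      (by fun_prop)]
    refine (integral_prod _ hcomp).trans ?_
    refine integral_congr_ae (ae_of_all _ fun x => integral_congr_ae (ae_of_all _ fun y => ?_))
    simp only [Function.comp_apply, hq]
    rw [← exp_add, ← sub_eq_add_neg, chaos_rotation hσ]
  have hup : (∫ x, exp (q x) ∂stdGauss ι) * ∫ x, exp (-q x) ∂stdGauss ι
      ≤ exp (4 * ∑ e, θ e ^ 2) := by
    rw [hmul]
    calc _ ≤ ∫ x, exp (∑ e, (2 * θ e ^ 2) * x e ^ 2) ∂stdGauss ι := by
          refine integral_mono_of_nonneg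
            (ae_of_all _ fun x => integral_nonneg fun y => (exp_pos _).le)
            (integrable_exp_quadratic fun e => by linarith [hsq e]) (ae_of_all _ fun x => ?_)
          simp only
          rw [integral_exp_linear]
          refine exp_le_exp.2 ?_
          have e1 : ∑ e, θ e ^ 2 * x (σ.symm e) ^ 2 = ∑ e, θ e ^ 2 * x e ^ 2 := by
            rw [← Equiv.sum_comp σ fun e => θ e ^ 2 * x (σ.symm e) ^ 2]
            simp [hσ]
          have e2 : ∑ e, θ e ^ 2 * x (σ e) ^ 2 = ∑ e, θ e ^ 2 * x e ^ 2 := by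
            rw [← Equiv.sum_comp σ fun e => θ e ^ 2 * x e ^ 2]
            simp [hσ]
          calc _ ≤ ∑ e, (θ e ^ 2 * x (σ.symm e) ^ 2 + θ e ^ 2 * x (σ e) ^ 2) := by
                rw [Finset.sum_div]
                refine Finset.sum_le_sum fun e _ => ?_
                nlinarith [mul_nonneg (sq_nonneg (θ e)) (sq_nonneg (x (σ.symm e) - x (σ e)))]
            _ = _ := by
                rw [Finset.sum_add_distrib, e1, e2, ← Finset.sum_add_distrib]
                exact Finset.sum_congr rfl fun e _ => by ring
      _ ≤ exp (2 * ∑ e, 2 * θ e ^ 2) := integral_exp_quadratic_le (fun e => by positivity) hsq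
      _ = exp (4 * ∑ e, θ e ^ 2) := by
          rw [← Finset.mul_sum]
          ring_nf
  have hI : 0 ≤ ∫ x, exp (q x) ∂stdGauss ι := integral_nonneg fun x => (exp_pos _).le
  have hfin : (∫ x, exp (q x) ∂stdGauss ι) * exp (-∑ e with σ e = e, θ e)
      ≤ exp (4 * ∑ e, θ e ^ 2) := (mul_le_mul_of_nonneg_left hlow hI).trans hup
  rw [exp_neg, ← div_eq_mul_inv, div_le_iff₀ (exp_pos _)] at hfin
  rwa [add_comm, exp_add]

end Chaos

section Concentration

variable {ι : Type*} [Fintype ι]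

lemma continuous_of_weighted_lipschitz {F : (ι → ℝ) → ℝ} {L : ι → ℝ}
    (hF : ∀ x y, |F x - F y| ≤ ∑ e, L e * |x e - y e|) : Continuous F := by
  refine continuous_iff_continuousAt.2 fun y => ?_
  rw [ContinuousAt, tendsto_iff_dist_tendsto_zero]
  have hc : Tendsto (fun x : ι → ℝ => ∑ e, L e * |x e - y e|) (𝓝 y) (𝓝 0) := by
    have h : Continuous fun x : ι → ℝ => ∑ e, L e * |x e - y e| := by fun_prop
    simpa using h.tendsto y
  exact squeeze_zero (fun x => dist_nonneg) (fun x => by rw [Real.dist_eq]; exact hF x y) hc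

lemma integrable_abs_eval (e : ι) : Integrable (fun x : ι → ℝ => |x e|) (stdGauss ι) :=
  (integrable_eval e).abs

lemma integrable_of_weighted_lipschitz {F : (ι → ℝ) → ℝ} {L : ι → ℝ}
    (hF : ∀ x y, |F x - F y| ≤ ∑ e, L e * |x e - y e|) : Integrable F (stdGauss ι) := by
  have hi : Integrable (fun x : ι → ℝ => |F 0| + ∑ e, L e * |x e|) (stdGauss ι) :=
    (integrable_const _).add (integrable_finsetSum _ fun e _ => (integrable_abs_eval e).const_mul _)
  refine hi.mono' (continuous_of_weighted_lipschitz hF).aestronglyMeasurable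
    (ae_of_all _ fun x => ?_)
  have h := hF x 0
  simp only [Pi.zero_apply, sub_zero] at h
  rw [norm_eq_abs]
  calc |F x| = |F 0 + (F x - F 0)| := by ring_nf
    _ ≤ |F 0| + |F x - F 0| := abs_add_le _ _
    _ ≤ _ := by gcongr

lemma integrable_exp_mul_abs_gaussianReal (l : ℝ) :
    Integrable (fun x => exp (l * |x|)) (gaussianReal 0 1) := by
  refine ((integrable_exp_mul_gaussianReal l).add (integrable_exp_mul_gaussianReal (-l))).mono'
    (by fun_prop) (ae_of_all _ fun x => ?_)
  simp only [norm_eq_abs, abs_exp, Pi.add_apply]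
  rcases abs_cases x with ⟨h, _⟩ | ⟨h, _⟩
  · rw [h]
    linarith [exp_pos (-l * x)]
  · rw [h, mul_neg, ← neg_mul]
    linarith [exp_pos (l * x)]

lemma integrable_exp_of_weighted_lipschitz {F : (ι → ℝ) → ℝ} {L : ι → ℝ}
    (hF : ∀ x y, |F x - F y| ≤ ∑ e, L e * |x e - y e|) :
    Integrable (fun x => exp (F x)) (stdGauss ι) := by
  have hi : Integrable (fun x : ι → ℝ => ∏ e, exp (L e * |x e|)) (stdGauss ι) :=
    Integrable.fintype_prod (f := fun e x => exp (L e * |x|))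
      fun e => integrable_exp_mul_abs_gaussianReal (L e)
  refine (hi.const_mul (exp (F 0))).mono'
    (continuous_of_weighted_lipschitz hF).rexp.aestronglyMeasurable (ae_of_all _ fun x => ?_)
  have h := hF x 0
  simp only [Pi.zero_apply, sub_zero] at h
  rw [norm_eq_abs, abs_exp, ← exp_sum, ← exp_add]
  exact exp_le_exp.2 (by linarith [le_abs_self (F x - F 0)])

lemma integrable_gaussianReal_of_lipschitz {H : ℝ → ℝ} {L : ℝ}
    (hH : ∀ x y, |H x - H y| ≤ L * |x - y|) :
    Integrable H (gaussianReal 0 1) ∧ Integrable (fun x => exp (H x)) (gaussianReal 0 1) := by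
  have hH' : ∀ x y : Unit → ℝ, |H (x ()) - H (y ())| ≤ ∑ e, L * |x e - y e| := by
    intro x y
    simpa using hH (x ()) (y ())
  have hmp := (measurePreserving_piUnique fun _ : Unit => gaussianReal 0 1)
  constructor
  · exact (hmp.integrable_comp_emb (MeasurableEquiv.measurableEmbedding _)).1
      (integrable_of_weighted_lipschitz (F := fun x : Unit → ℝ => H (x ())) hH')
  · exact (hmp.integrable_comp_emb (MeasurableEquiv.measurableEmbedding _)).1
      (integrable_exp_of_weighted_lipschitz (F := fun x : Unit → ℝ => H (x ())) hH')

/-- One-dimensional Gaussian concentration, by symmetrization. -/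
lemma integral_exp_gaussianReal_le_of_lipschitz {G : ℝ → ℝ} {L : ℝ}
    (hG : ∀ x y, |G x - G y| ≤ L * |x - y|) :
    ∫ x, exp (G x) ∂gaussianReal 0 1 ≤ exp (∫ x, G x ∂gaussianReal 0 1 + L ^ 2) := by
  set ν := gaussianReal 0 1 with hν
  obtain ⟨hGi, hGe⟩ := integrable_gaussianReal_of_lipschitz hG
  obtain ⟨-, hGe'⟩ := integrable_gaussianReal_of_lipschitz (H := fun x => -G x) (L := L)
    fun x y => by
      rw [neg_sub_neg, abs_sub_comm]
      exact hG x y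
  have hlow : exp (-∫ x, G x ∂ν) ≤ ∫ x, exp (-G x) ∂ν := by
    have h := exp_integral_le hGi.neg hGe'
    simp only [Pi.neg_apply] at h
    rwa [integral_neg] at h
  have hp1 : Integrable (fun p : ℝ × ℝ => exp (G p.1) * exp (-G p.2)) (ν.prod ν) :=
    hGe.mul_prod hGe'
  have hp2 : Integrable (fun p : ℝ × ℝ => exp (-G p.1) * exp (G p.2)) (ν.prod ν) :=
    hGe'.mul_prod hGe
  have hl1 : Integrable (fun p : ℝ × ℝ => exp (L * p.1) * exp (-L * p.2)) (ν.prod ν) :=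
    (integrable_exp_mul_gaussianReal L).mul_prod (integrable_exp_mul_gaussianReal (-L))
  have hl2 : Integrable (fun p : ℝ × ℝ => exp (-L * p.1) * exp (L * p.2)) (ν.prod ν) :=
    (integrable_exp_mul_gaussianReal (-L)).mul_prod (integrable_exp_mul_gaussianReal L)
  have hcosh : ∫ p : ℝ × ℝ, (exp (G p.1) * exp (-G p.2) + exp (-G p.1) * exp (G p.2)) ∂ν.prod ν
      ≤ ∫ p : ℝ × ℝ, (exp (L * p.1) * exp (-L * p.2) + exp (-L * p.1) * exp (L * p.2))
        ∂ν.prod ν := by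
    refine integral_mono (hp1.add hp2) (hl1.add hl2) fun p => ?_
    have h : cosh (G p.1 - G p.2) ≤ cosh (L * (p.1 - p.2)) := cosh_le_cosh.2 <| by
      rw [abs_mul]
      exact (hG p.1 p.2).trans (mul_le_mul_of_nonneg_right (le_abs_self L) (abs_nonneg _))
    rw [cosh_eq, cosh_eq] at h
    simp only [← exp_add]
    have e1 : G p.1 + -G p.2 = G p.1 - G p.2 := by ring
    have e2 : -G p.1 + G p.2 = -(G p.1 - G p.2) := by ring
    have e3 : L * p.1 + -L * p.2 = L * (p.1 - p.2) := by ring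
    have e4 : -L * p.1 + L * p.2 = -(L * (p.1 - p.2)) := by ring
    rw [e1, e2, e3, e4]
    linarith
  rw [integral_add hp1 hp2, integral_add hl1 hl2,
    integral_prod_mul (fun x => exp (G x)) (fun x => exp (-G x)),
    integral_prod_mul (fun x => exp (-G x)) (fun x => exp (G x)),
    integral_prod_mul (fun x => exp (L * x)) (fun x => exp (-L * x)),
    integral_prod_mul (fun x => exp (-L * x)) (fun x => exp (L * x)),
    integral_exp_mul_gaussianReal, integral_exp_mul_gaussianReal] at hcosh
  have hL : exp (L ^ 2 / 2) * exp ((-L) ^ 2 / 2) = exp (L ^ 2) := by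
    rw [← exp_add]
    ring_nf
  have hup : (∫ x, exp (G x) ∂ν) * ∫ x, exp (-G x) ∂ν ≤ exp (L ^ 2) := by
    rw [mul_comm (exp ((-L) ^ 2 / 2)), hL, mul_comm (∫ x, exp (-G x) ∂ν)] at hcosh
    linarith
  have hI : 0 ≤ ∫ x, exp (G x) ∂ν := integral_nonneg fun x => (exp_pos _).le
  have hfin := (mul_le_mul_of_nonneg_left hlow hI).trans hup
  rw [exp_neg, ← div_eq_mul_inv, div_le_iff₀ (exp_pos _)] at hfin
  rwa [add_comm, exp_add]

lemma integral_exp_fin_le_of_weighted_lipschitz (n : ℕ) :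
    ∀ {F : (Fin n → ℝ) → ℝ} {L : Fin n → ℝ},
      (∀ x y, |F x - F y| ≤ ∑ e, L e * |x e - y e|) →
      ∫ x, exp (F x) ∂stdGauss (Fin n) ≤ exp (∫ x, F x ∂stdGauss (Fin n) + ∑ e, L e ^ 2) := by
  induction n with
  | zero =>
    intro F L _
    have h : ∀ x, F x = F 0 := fun x => congrArg F (Subsingleton.elim _ _)
    simp_rw [h]
    simp
  | succ n ih =>
    intro F L hF
    have hmp := (measurePreserving_piFinSuccAbove (fun _ : Fin (n + 1) => gaussianReal 0 1) 0).symm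
    change MeasurePreserving _ ((gaussianReal 0 1).prod (stdGauss (Fin n)))
      (stdGauss (Fin (n + 1))) at hmp
    have hcons : ∀ p : ℝ × (Fin n → ℝ),
        (MeasurableEquiv.piFinSuccAbove (fun _ : Fin (n + 1) => ℝ) 0).symm p
          = Fin.cons p.1 p.2 := by
      intro p
      simp [MeasurableEquiv.piFinSuccAbove_symm_apply, Fin.insertNthEquiv]
    have hFi := hmp.integrable_comp_of_integrable (integrable_of_weighted_lipschitz hF)
    have hFe := hmp.integrable_comp_of_integrable (integrable_exp_of_weighted_lipschitz hF)
    simp only [Function.comp_def, hcons] at hFi hFe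
    have hF0 : ∀ t (x y : Fin n → ℝ), |F (Fin.cons t x) - F (Fin.cons t y)|
        ≤ ∑ e, L e.succ * |x e - y e| := by
      intro t x y
      simpa [Fin.sum_univ_succ] using hF (Fin.cons t x) (Fin.cons t y)
    have hF1 : ∀ t u (x : Fin n → ℝ), |F (Fin.cons t x) - F (Fin.cons u x)| ≤ L 0 * |t - u| := by
      intro t u x
      simpa [Fin.sum_univ_succ] using hF (Fin.cons t x) (Fin.cons u x)
    have hG : ∀ t u, |∫ x, F (Fin.cons t x) ∂stdGauss (Fin n) + ∑ e : Fin n, L e.succ ^ 2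
        - (∫ x, F (Fin.cons u x) ∂stdGauss (Fin n) + ∑ e : Fin n, L e.succ ^ 2)|
        ≤ L 0 * |t - u| := by
      intro t u
      rw [add_sub_add_right_eq_sub, ← integral_sub (integrable_of_weighted_lipschitz (hF0 t))
        (integrable_of_weighted_lipschitz (hF0 u)), ← norm_eq_abs]
      refine (norm_integral_le_of_norm_le_const (C := L 0 * |t - u|)
        (ae_of_all _ fun x => hF1 t u x)).trans_eq ?_
      simp
    have h1 := integral_exp_gaussianReal_le_of_lipschitz hG
    have hGi : Integrable (fun t => ∫ x, F (Fin.cons t x) ∂stdGauss (Fin n)) (gaussianReal 0 1) :=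
      hFi.integral_prod_left
    have hGe : Integrable (fun t => ∫ x, exp (F (Fin.cons t x)) ∂stdGauss (Fin n))
      (gaussianReal 0 1) := hFe.integral_prod_left
    have hGe' : Integrable (fun t => exp (∫ x, F (Fin.cons t x) ∂stdGauss (Fin n)
        + ∑ e : Fin n, L e.succ ^ 2)) (gaussianReal 0 1) :=
      (integrable_gaussianReal_of_lipschitz hG).2
    rw [integral_add hGi (integrable_const _)] at h1
    rw [← hmp.integral_comp', ← hmp.integral_comp']
    simp only [hcons]
    rw [integral_prod _ hFi, integral_prod _ hFe, Fin.sum_univ_succ]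
    calc _ ≤ ∫ t, exp (∫ x, F (Fin.cons t x) ∂stdGauss (Fin n) + ∑ e : Fin n, L e.succ ^ 2)
          ∂gaussianReal 0 1 := integral_mono hGe hGe' fun t => ih (hF0 t)
      _ ≤ _ := h1
      _ = _ := by
        simp only [integral_const, probReal_univ, one_smul]
        ring_nf

/-- Exponential concentration of a function of independent standard Gaussian variables which is
Lipschitz in each coordinate. -/
lemma integral_exp_le_of_weighted_lipschitz {F : (ι → ℝ) → ℝ} {L : ι → ℝ}
    (hF : ∀ x y, |F x - F y| ≤ ∑ e, L e * |x e - y e|) :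
    ∫ x, exp (F x) ∂stdGauss ι ≤ exp (∫ x, F x ∂stdGauss ι + ∑ e, L e ^ 2) := by
  set σ := Fintype.equivFin ι
  have hmp := measurePreserving_comp_equiv σ
  have hF' : ∀ x y : Fin (Fintype.card ι) → ℝ,
      |F (fun e => x (σ e)) - F (fun e => y (σ e))| ≤ ∑ i, L (σ.symm i) * |x i - y i| := by
    intro x y
    refine (hF _ _).trans_eq ?_
    rw [← Equiv.sum_comp σ]
    simp
  have h := integral_exp_fin_le_of_weighted_lipschitz _ hF'
  rw [Equiv.sum_comp σ.symm fun e => L e ^ 2] at h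
  have hc := continuous_of_weighted_lipschitz hF
  rw [← hmp.map_eq, integral_map hmp.aemeasurable hc.rexp.aestronglyMeasurable,
    integral_map hmp.aemeasurable hc.aestronglyMeasurable]
  exact h

end Concentration

section LogSumExp

variable {G : Type*} [Fintype G] [Nonempty G]

lemma sum_exp_pos (u : G → ℝ) : 0 < ∑ g, exp (u g) :=
  Finset.sum_pos (fun _ _ => exp_pos _) univ_nonempty

lemma log_sum_exp_le_add {u v : G → ℝ} {c : ℝ} (h : ∀ g, u g ≤ v g + c) :
    log (∑ g, exp (u g)) ≤ log (∑ g, exp (v g)) + c := by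
  rw [← log_exp c, ← log_mul (sum_exp_pos v).ne' (exp_pos c).ne']
  refine log_le_log (sum_exp_pos u) ?_
  rw [Finset.sum_mul]
  refine Finset.sum_le_sum fun g _ => ?_
  rw [← exp_add]
  exact exp_le_exp.2 (h g)

lemma abs_log_sum_exp_sub_le {u v : G → ℝ} {c : ℝ} (h : ∀ g, |u g - v g| ≤ c) :
    |log (∑ g, exp (u g)) - log (∑ g, exp (v g))| ≤ c := by
  rw [abs_sub_le_iff]
  constructor
  · linarith [log_sum_exp_le_add (u := u) (v := v) fun g => by linarith [(abs_le.1 (h g)).2]]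
  · linarith [log_sum_exp_le_add (u := v) (v := u) fun g => by linarith [(abs_le.1 (h g)).1]]

lemma abs_log_sum_exp_le (u : G → ℝ) :
    |log (∑ g, exp (u g))| ≤ log (Fintype.card G) + ∑ g, |u g| := by
  have h := abs_log_sum_exp_sub_le (u := u) (v := 0) (c := ∑ g, |u g|) fun g => by
    simpa using Finset.single_le_sum (f := fun g => |u g|) (fun _ _ => abs_nonneg _)
      (Finset.mem_univ g)
  simp only [Pi.zero_apply, exp_zero, sum_const, card_univ, nsmul_eq_mul, mul_one] at h
  have h0 : 0 ≤ log (Fintype.card G) := log_natCast_nonneg _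
  rw [abs_le] at h ⊢
  constructor <;> linarith [h.1, h.2]

lemma integrable_log_sum_exp {Ω : Type*} [MeasurableSpace Ω] {P : Measure Ω}
    [IsProbabilityMeasure P] {u : G → Ω → ℝ} (hm : ∀ g, Measurable (u g))
    (hu : ∀ g, Integrable (u g) P) : Integrable (fun ω => log (∑ g, exp (u g ω))) P := by
  refine Integrable.mono' (g := fun ω => log (Fintype.card G) + ∑ g, |u g ω|)
    ((integrable_const _).add (integrable_finsetSum _ fun g _ => (hu g).abs))
    (Measurable.aestronglyMeasurable (by fun_prop)) (ae_of_all _ fun ω => ?_)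
  exact abs_log_sum_exp_le fun g => u g ω

/-- Gibbs' variational lower bound for a perturbed log-partition function. -/
lemma log_sum_exp_add_ge (u m : G → ℝ) :
    log (∑ g, exp (u g)) + ∑ g, exp (u g) / (∑ k, exp (u k)) * m g
      ≤ log (∑ g, exp (m g + u g)) := by
  set S := ∑ k, exp (u k) with hS
  have hSp : 0 < S := sum_exp_pos u
  have h := convexOn_exp.map_sum_le (t := Finset.univ) (w := fun g => exp (u g) / S) (p := m)
    (fun g _ => by positivity) (by rw [← Finset.sum_div, ← hS, div_self hSp.ne'])
    (fun g _ => Set.mem_univ _)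
  simp only [smul_eq_mul] at h
  rw [← le_sub_iff_add_le', ← log_div (sum_exp_pos fun g => m g + u g).ne' hSp.ne',
    le_log_iff_exp_le (div_pos (sum_exp_pos fun g => m g + u g) hSp), Finset.sum_div]
  refine h.trans_eq (Finset.sum_congr rfl fun g _ => ?_)
  rw [exp_add]
  ring

end LogSumExp

lemma integrable_log_and_integral_log_le {Ω : Type*} [MeasurableSpace Ω] {P : Measure Ω}
    [IsProbabilityMeasure P] {Y : Ω → ℝ} (hm : Measurable Y) (hY : Integrable Y P)
    (h1 : ∀ ω, 1 ≤ Y ω) :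
    Integrable (fun ω => log (Y ω)) P ∧ ∫ ω, log (Y ω) ∂P ≤ log (∫ ω, Y ω ∂P) := by
  have hi : Integrable (fun ω => log (Y ω)) P := by
    refine hY.mono' hm.log.aestronglyMeasurable (ae_of_all _ fun ω => ?_)
    rw [norm_eq_abs, abs_of_nonneg (log_nonneg (h1 ω))]
    exact log_le_self (zero_le_one.trans (h1 ω))
  refine ⟨hi, ?_⟩
  have h2 : (1 : ℝ) ≤ ∫ ω, Y ω ∂P := by
    simpa using integral_mono (integrable_const (1 : ℝ)) hY h1
  rw [le_log_iff_exp_le (by linarith)]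
  have he : ∀ ω, exp (log (Y ω)) = Y ω := fun ω => exp_log (by linarith [h1 ω])
  have h3 := exp_integral_le hi (by simpa only [he] using hY)
  simpa only [he] using h3

section GroupAction

variable {ι : Type*} [Fintype ι] {G : Type*} [Group G]

/-- The energy `∑ r e * x e * w (g e)` of two fields, one of which is permuted by `g`. -/
def energy (T : G →* Equiv.Perm ι) (r : ι → ℝ) (g : G) (x w : ι → ℝ) : ℝ :=
  ∑ e, r e * x e * w (T g e)

variable {T : G →* Equiv.Perm ι} {r : ι → ℝ}

lemma sum_energy_coeff_sq (hr : ∀ g e, r (T g e) = r e) (g : G) (w : ι → ℝ) :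
    ∑ e, (r e * w (T g e)) ^ 2 = ∑ e, r e ^ 2 * w e ^ 2 := by
  rw [← Equiv.sum_comp (T g) fun e => r e ^ 2 * w e ^ 2]
  simp [hr, mul_pow]

lemma energy_eq (T : G →* Equiv.Perm ι) (r : ι → ℝ) (g : G) (x w : ι → ℝ) :
    energy T r g x w = ∑ e, (r e * w (T g e)) * x e :=
  Finset.sum_congr rfl fun e _ => by ring

lemma sum_sq_overlap (hr : ∀ g e, r (T g e) = r e) (g k : G) (w : ι → ℝ) :
    ∑ e, (r e * w (T g e) + r e * w (T k e)) ^ 2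
      = 2 * ∑ e, r e ^ 2 * w e ^ 2 + 2 * ∑ e, r e ^ 2 * (w e * w (T (k * g⁻¹) e)) := by
  have h1 : ∑ e, r e ^ 2 * (w e * w (T (k * g⁻¹) e))
      = ∑ e, (r e * w (T g e)) * (r e * w (T k e)) := by
    rw [← Equiv.sum_comp (T g) fun e => r e ^ 2 * (w e * w (T (k * g⁻¹) e))]
    refine Finset.sum_congr rfl fun e _ => ?_
    rw [hr, ← Equiv.Perm.mul_apply, ← map_mul, inv_mul_cancel_right]
    ring
  rw [h1, two_mul (∑ e, r e ^ 2 * w e ^ 2)]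
  nth_rewrite 1 [← sum_energy_coeff_sq hr g]
  rw [← sum_energy_coeff_sq hr k, Finset.mul_sum, ← Finset.sum_add_distrib,
    ← Finset.sum_add_distrib]
  exact Finset.sum_congr rfl fun e _ => by ring

variable [Fintype G]

/-- The normalized second moment of the partition function, given the field `w`. -/
def secondMoment (T : G →* Equiv.Perm ι) (r : ι → ℝ) (w : ι → ℝ) : ℝ :=
  (∑ g, exp (∑ e, r e ^ 2 * (w e * w (T g e)))) / Fintype.card G

lemma secondMoment_nonneg (T : G →* Equiv.Perm ι) (r w : ι → ℝ) : 0 ≤ secondMoment T r w := by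
  unfold secondMoment
  positivity

lemma min_one_le_exp_mul_log {X s : ℝ} (hX : 0 < X) (hs0 : 0 ≤ s) (hs1 : s ≤ 1) :
    min 1 X ≤ exp (s * log X) := by
  rcases le_total 1 X with h | h
  · rw [min_eq_left h]
    exact one_le_exp (mul_nonneg hs0 (log_nonneg h))
  · rw [min_eq_right h]
    calc X = exp (log X) := (exp_log hX).symm
      _ ≤ _ := exp_le_exp.2 (by nlinarith [log_nonpos hX.le h])

lemma truncated_le_min_one {X t : ℝ} (hX : 0 ≤ X) (ht : 1 ≤ t) : (X - X ^ 2 / t) / t ≤ min 1 X := by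
  have ht0 : 0 < t := by linarith
  have h1 : (X - X ^ 2 / t) ≤ X := by
    have : 0 ≤ X ^ 2 / t := by positivity
    linarith
  have h2 : X - X ^ 2 / t ≤ t := by
    rw [sub_le_iff_le_add, ← sub_le_iff_le_add', le_div_iff₀ ht0]
    nlinarith [sq_nonneg (X - t)]
  rw [div_le_iff₀ ht0]
  refine le_min (by linarith) ?_ |>.trans (min_mul_of_nonneg 1 X ht0.le).ge
  nlinarith

/-- Lower bound on the expected log-partition function with one field frozen, by combining the
second moment method with Gaussian concentration. -/
lemma integral_log_sum_energy_ge (hr : ∀ g e, r (T g e) = r e) {w M : ι → ℝ}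
    (hM : ∀ g e, |w (T g e)| ≤ M e) {s : ℝ} (hs0 : 0 < s) (hs1 : s ≤ 1) :
    log (Fintype.card G) + (∑ e, r e ^ 2 * w e ^ 2) / 2
      - log (4 * secondMoment T r w + 2) / s - s * ∑ e, r e ^ 2 * M e ^ 2
      ≤ ∫ x, log (∑ g, exp (energy T r g x w)) ∂stdGauss ι := by
  set F : (ι → ℝ) → ℝ := fun x => log (∑ g, exp (energy T r g x w)) with hF
  set N : ℝ := (Fintype.card G : ℝ) with hN
  have hN0 : 0 < N := by
    rw [hN]
    exact_mod_cast Fintype.card_pos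
  set v := ∑ e, r e ^ 2 * w e ^ 2 with hv
  set R := secondMoment T r w with hR
  have hR0 : 0 ≤ R := secondMoment_nonneg T r w
  have hLip : ∀ x y, |F x - F y| ≤ ∑ e, |r e| * M e * |x e - y e| := by
    intro x y
    refine abs_log_sum_exp_sub_le fun g => ?_
    rw [energy, energy, ← Finset.sum_sub_distrib]
    refine (abs_sum_le_sum_abs _ _).trans (Finset.sum_le_sum fun e _ => ?_)
    have : r e * x e * w (T g e) - r e * y e * w (T g e) = r e * w (T g e) * (x e - y e) := by ring
    rw [this, abs_mul, abs_mul]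
    gcongr
    exact hM g e
  set c := log N + v / 2 with hc
  set X : (ι → ℝ) → ℝ := fun x => (∑ g, exp (energy T r g x w)) / (N * exp (v / 2)) with hX
  have hXpos : ∀ x, 0 < X x := fun x => div_pos (sum_exp_pos _) (by positivity)
  have hlogX : ∀ x, log (X x) = F x - c := by
    intro x
    rw [hX, log_div (sum_exp_pos _).ne' (by positivity), log_mul hN0.ne' (exp_pos _).ne', log_exp]
  have hie : ∀ g, Integrable (fun x => exp (energy T r g x w)) (stdGauss ι) := by
    intro g
    simp_rw [energy_eq]
    exact integrable_exp_linear _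
  have hXi : Integrable X (stdGauss ι) := (integrable_finsetSum _ fun g _ => hie g).div_const _
  have hX1 : ∫ x, X x ∂stdGauss ι = 1 := by
    simp only [hX]
    rw [integral_div, integral_finsetSum _ fun g _ => hie g]
    simp_rw [energy_eq, integral_exp_linear, sum_energy_coeff_sq hr]
    rw [Finset.sum_const, card_univ, nsmul_eq_mul, ← hN]
    exact div_self (by positivity)
  have hXsq : ∀ x, X x ^ 2 = (∑ g, ∑ k, exp (∑ e, (r e * w (T g e) + r e * w (T k e)) * x e))
      / (N * exp (v / 2)) ^ 2 := by
    intro x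
    simp only [hX]
    rw [div_pow, sq (∑ g, _), Finset.sum_mul_sum]
    simp_rw [← exp_add, energy_eq, ← Finset.sum_add_distrib, add_mul]
  have hX2i : Integrable (fun x => X x ^ 2) (stdGauss ι) := by
    simp_rw [hXsq]
    exact (integrable_finsetSum _ fun g _ => integrable_finsetSum _ fun k _ =>
      integrable_exp_linear _).div_const _
  have hX2 : ∫ x, X x ^ 2 ∂stdGauss ι = R := by
    simp_rw [hXsq]
    rw [integral_div, integral_finsetSum _ fun g _ => integrable_finsetSum _ fun k _ =>
      integrable_exp_linear _]
    simp_rw [integral_finsetSum _ fun k _ => integrable_exp_linear _, integral_exp_linear,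
      sum_sq_overlap hr, ← hv]
    have h1 : ∀ g : G, ∑ k, exp ((2 * v + 2 * ∑ e, r e ^ 2 * (w e * w (T (k * g⁻¹) e))) / 2)
        = exp v * (N * R) := by
      intro g
      refine (Equiv.sum_comp (Equiv.mulRight g⁻¹) fun k =>
        exp ((2 * v + 2 * ∑ e, r e ^ 2 * (w e * w (T k e))) / 2)).trans ?_
      rw [hR, secondMoment, ← hN,
        mul_div_cancel₀ _ hN0.ne', Finset.mul_sum _ _ (exp v)]
      refine Finset.sum_congr rfl fun k _ => ?_
      rw [← exp_add]
      ring_nf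
    simp_rw [h1]
    rw [Finset.sum_const, card_univ, nsmul_eq_mul, ← hN, mul_pow, ← exp_nat_mul]
    have h2 : ((2 : ℕ) : ℝ) * (v / 2) = v := by
      push_cast
      ring
    rw [h2]
    field_simp
  set t := 2 * R + 1 with ht
  have ht1 : 1 ≤ t := by linarith
  have hsF : ∀ x y, |(s * (F x - c)) - (s * (F y - c))| ≤ ∑ e, (s * (|r e| * M e)) * |x e - y e| := by
    intro x y
    have : s * (F x - c) - s * (F y - c) = s * (F x - F y) := by ring
    rw [this, abs_mul, abs_of_pos hs0]
    simp_rw [mul_assoc s, ← Finset.mul_sum]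
    exact mul_le_mul_of_nonneg_left (hLip x y) hs0.le
  have hup := integral_exp_le_of_weighted_lipschitz hsF
  have hei := integrable_exp_of_weighted_lipschitz hsF
  have hFi := integrable_of_weighted_lipschitz hLip
  clear_value X
  have hlow : 1 / (4 * R + 2) ≤ ∫ x, exp (s * (F x - c)) ∂stdGauss ι := by
    calc 1 / (4 * R + 2) ≤ (1 - R / t) / t := by
          rw [ht]
          have : 0 < 2 * R + 1 := by linarith
          rw [one_sub_div this.ne', div_div, div_le_div_iff₀ (by linarith) (by positivity)]
          nlinarith
      _ = ∫ x, (X x - X x ^ 2 / t) / t ∂stdGauss ι := by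
          rw [integral_div, integral_sub hXi (hX2i.div_const _), integral_div, hX1, hX2]
      _ ≤ _ := by
          refine integral_mono ((hXi.sub (hX2i.div_const _)).div_const _) hei fun x => ?_
          have h := min_one_le_exp_mul_log (hXpos x) hs0.le hs1
          rw [hlogX] at h
          exact (truncated_le_min_one (hXpos x).le ht1).trans h
  have hfin := hlow.trans hup
  rw [integral_const_mul, integral_sub hFi (integrable_const _), integral_const, probReal_univ,
    one_smul, one_div, ← exp_log (show 0 < 4 * R + 2 by linarith), ← exp_neg, exp_le_exp] at hfin
  have hK : ∑ e, (s * (|r e| * M e)) ^ 2 = s ^ 2 * ∑ e, r e ^ 2 * M e ^ 2 := by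
    rw [Finset.mul_sum]
    refine Finset.sum_congr rfl fun e _ => ?_
    rw [mul_pow, mul_pow, sq_abs]
  rw [hK] at hfin
  have hdiv : log (4 * R + 2) / s * s = log (4 * R + 2) := div_mul_cancel₀ _ hs0.ne'
  refine le_of_mul_le_mul_left ?_ hs0
  change _ ≤ s * ∫ x, F x ∂stdGauss ι
  nlinarith

end GroupAction

section GroupAction

variable {ι : Type*} [Fintype ι] {G : Type*} [Group G]
  {T : G →* Equiv.Perm ι} {r : ι → ℝ}

lemma integrable_energy (T : G →* Equiv.Perm ι) (r : ι → ℝ) (g : G) :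
    Integrable (fun p : (ι → ℝ) × (ι → ℝ) => energy T r g p.1 p.2)
      ((stdGauss ι).prod (stdGauss ι)) := by
  refine integrable_finsetSum _ fun e _ => ?_
  simp_rw [mul_assoc]
  exact ((integrable_eval e).mul_prod (integrable_eval (T g e))).const_mul _

lemma measurable_energy (T : G →* Equiv.Perm ι) (r : ι → ℝ) (g : G) :
    Measurable fun p : (ι → ℝ) × (ι → ℝ) => energy T r g p.1 p.2 := by
  unfold energy
  fun_prop

lemma energy_permute (T : G →* Equiv.Perm ι) (r : ι → ℝ) (k g : G) (x w : ι → ℝ) :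
    energy T r g x (fun e => w (T k e)) = energy T r (k * g) x w := by
  simp [energy]

variable [Fintype G]

lemma integrable_log_sum_energy (T : G →* Equiv.Perm ι) (r : ι → ℝ) :
    Integrable (fun p : (ι → ℝ) × (ι → ℝ) => log (∑ g, exp (energy T r g p.1 p.2)))
      ((stdGauss ι).prod (stdGauss ι)) :=
  integrable_log_sum_exp (measurable_energy T r) (integrable_energy T r)

lemma integrable_exp_sq_div_four :
    Integrable (fun x => exp (x ^ 2 / 4)) (gaussianReal 0 1) := by
  simpa [div_eq_inv_mul] using integrable_exp_mul_sq_gaussianReal (l := 1 / 4) (by norm_num)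

lemma integral_exp_sq_div_four : ∫ x, exp (x ^ 2 / 4) ∂gaussianReal 0 1 = √2 := by
  have h := integral_exp_mul_sq_gaussianReal (l := 1 / 4) (by norm_num)
  have h2 : (√(1 - 2 * (1 / 4)))⁻¹ = √2 := by
    rw [← sqrt_inv]
    norm_num
  rw [h2] at h
  rw [← h]
  simp [div_eq_inv_mul]

/-- A soft maximum of `w f ^ 2` over a finite set has logarithmic mean. -/
lemma integral_soft_max_sq_le {O : Finset ι} (hO : O.Nonempty) :
    Integrable (fun w => log (∑ f ∈ O, exp (w f ^ 2 / 4))) (stdGauss ι) ∧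
      ∫ w, log (∑ f ∈ O, exp (w f ^ 2 / 4)) ∂stdGauss ι ≤ log (√2 * #O) := by
  have hi : ∀ f : ι, Integrable (fun w => exp (w f ^ 2 / 4)) (stdGauss ι) := fun f =>
    (measurePreserving_eval (fun _ => gaussianReal 0 1) f).integrable_comp_of_integrable
      integrable_exp_sq_div_four
  have he : ∀ f : ι, ∫ w, exp (w f ^ 2 / 4) ∂stdGauss ι = √2 := by
    intro f
    rw [← integral_exp_sq_div_four]
    exact integral_comp_eval (μ := fun _ : ι => gaussianReal 0 1) (i := f)
      (f := fun x : ℝ => exp (x ^ 2 / 4)) (by fun_prop)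
  have h := integrable_log_and_integral_log_le (P := stdGauss ι)
    (Y := fun w => ∑ f ∈ O, exp (w f ^ 2 / 4)) (by fun_prop)
    (integrable_finsetSum _ fun f _ => hi f) fun w => by
      obtain ⟨f, hf⟩ := hO
      calc (1 : ℝ) ≤ exp (w f ^ 2 / 4) := one_le_exp (by positivity)
        _ ≤ _ := Finset.single_le_sum (f := fun f => exp (w f ^ 2 / 4))
          (fun _ _ => (exp_pos _).le) hf
  rw [integral_finsetSum _ fun f _ => hi f] at h
  simp_rw [he] at h
  rwa [Finset.sum_const, nsmul_eq_mul, mul_comm] at h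

/-- The first and second moments of the partition function control its quenched average. -/
lemma integral_log_sum_energy_prod_ge [DecidableEq ι] (hr : ∀ g e, r (T g e) = r e)
    (hr4 : ∀ e, r e ^ 2 ≤ 1 / 4) {O : ι → Finset ι} (hO : ∀ g e, T g e ∈ O e) {D : ℝ}
    (hD : ∀ e, (#(O e) : ℝ) ≤ D) {s : ℝ} (hs0 : 0 < s) (hs1 : s ≤ 1) :
    log (Fintype.card G) + (∑ e, r e ^ 2) / 2
      - log (4 * ((∑ g, exp (∑ e with T g e = e, r e ^ 2 + 4 * ∑ e, (r e ^ 2) ^ 2))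
          / Fintype.card G) + 2) / s
      - s * (4 * log (√2 * D) * ∑ e, r e ^ 2)
      ≤ ∫ p, log (∑ g, exp (energy T r g p.1 p.2)) ∂(stdGauss ι).prod (stdGauss ι) := by
  have hne : ∀ e, (O e).Nonempty := fun e => ⟨_, hO 1 e⟩
  set M : (ι → ℝ) → ι → ℝ := fun w e => √(4 * log (∑ f ∈ O e, exp (w f ^ 2 / 4))) with hMdef
  have hone : ∀ w : ι → ℝ, ∀ e f, f ∈ O e → exp (w f ^ 2 / 4) ≤ ∑ f ∈ O e, exp (w f ^ 2 / 4) :=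
    fun w e f hf => Finset.single_le_sum (f := fun f => exp (w f ^ 2 / 4))
      (fun _ _ => (exp_pos _).le) hf
  have hle : ∀ w : ι → ℝ, ∀ e f, f ∈ O e → w f ^ 2 ≤ 4 * log (∑ f ∈ O e, exp (w f ^ 2 / 4)) := by
    intro w e f hf
    have h := log_le_log (exp_pos _) (hone w e f hf)
    rw [log_exp] at h
    linarith
  have hM : ∀ w g e, |w (T g e)| ≤ M w e := fun w g e => abs_le_sqrt (hle w e _ (hO g e))
  have hMsq : ∀ w e, M w e ^ 2 = 4 * log (∑ f ∈ O e, exp (w f ^ 2 / 4)) := fun w e =>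
    sq_sqrt ((sq_nonneg _).trans (hle w e _ (hO 1 e)))
  have hpt := fun w => integral_log_sum_energy_ge hr (hM w) hs0 hs1
  simp_rw [hMsq] at hpt
  have hq : ∀ g, Integrable (fun w => exp (∑ e, r e ^ 2 * (w e * w (T g e)))) (stdGauss ι) :=
    fun g => integrable_exp_chaos (fun e => by rw [hr]) (fun e => sq_nonneg _) hr4
  have hRi : Integrable (fun w => 4 * secondMoment T r w + 2) (stdGauss ι) :=
    (((integrable_finsetSum _ fun g _ => hq g).div_const _).const_mul 4).add (integrable_const 2)
  obtain ⟨hlogi, hlog⟩ := integrable_log_and_integral_log_le (P := stdGauss ι)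
    (Y := fun w => 4 * secondMoment T r w + 2) (by unfold secondMoment; fun_prop) hRi
    fun w => by linarith [secondMoment_nonneg T r w]
  have hRle : ∫ w, (4 * secondMoment T r w + 2) ∂stdGauss ι
      ≤ 4 * ((∑ g, exp (∑ e with T g e = e, r e ^ 2 + 4 * ∑ e, (r e ^ 2) ^ 2))
          / Fintype.card G) + 2 := by
    unfold secondMoment
    rw [integral_add (((integrable_finsetSum _ fun g _ => hq g).div_const _).const_mul 4)
      (integrable_const 2), integral_const_mul, integral_div,
      integral_finsetSum _ fun g _ => hq g]
    simp only [integral_const, probReal_univ, one_smul]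
    gcongr with g
    exact integral_exp_chaos_le (fun e => by rw [hr]) (fun e => sq_nonneg _) hr4
  have hR0 : 0 < ∫ w, (4 * secondMoment T r w + 2) ∂stdGauss ι := by
    have : ∫ w : ι → ℝ, (2 : ℝ) ∂stdGauss ι ≤ ∫ w, (4 * secondMoment T r w + 2) ∂stdGauss ι :=
      integral_mono (integrable_const _) hRi fun w => by
        simp only
        linarith [secondMoment_nonneg T r w]
    simp only [integral_const, probReal_univ, one_smul] at this
    linarith
  have hlog2 := hlog.trans (log_le_log hR0 hRle)
  have hvi : ∀ e, Integrable (fun w : ι → ℝ => r e ^ 2 * w e ^ 2) (stdGauss ι) := fun e =>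
    (memLp_eval e).integrable_sq.const_mul _
  have hki : ∀ e, Integrable (fun w : ι → ℝ => r e ^ 2 * (4 * log (∑ f ∈ O e, exp (w f ^ 2 / 4))))
      (stdGauss ι) := fun e => ((integral_soft_max_sq_le (hne e)).1.const_mul 4).const_mul _
  have hk : ∫ w, ∑ e, r e ^ 2 * (4 * log (∑ f ∈ O e, exp (w f ^ 2 / 4))) ∂stdGauss ι
      ≤ 4 * log (√2 * D) * ∑ e, r e ^ 2 := by
    rw [integral_finsetSum _ fun e _ => hki e, Finset.mul_sum]
    refine Finset.sum_le_sum fun e _ => ?_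
    rw [integral_const_mul, integral_const_mul, mul_comm]
    have hc : (0 : ℝ) < #(O e) := by exact_mod_cast (hne e).card_pos
    gcongr
    exact (integral_soft_max_sq_le (hne e)).2.trans (log_le_log (by positivity)
      (mul_le_mul_of_nonneg_left (hD e) (sqrt_nonneg _)))
  have hA : Integrable (fun w : ι → ℝ => log (Fintype.card G) + (∑ e, r e ^ 2 * w e ^ 2) / 2)
      (stdGauss ι) :=
    (integrable_const _).add ((integrable_finsetSum _ fun e _ => hvi e).div_const _)
  have hB : Integrable (fun w : ι → ℝ => log (4 * secondMoment T r w + 2) / s) (stdGauss ι) :=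
    hlogi.div_const _
  have hC : Integrable (fun w : ι → ℝ =>
      s * ∑ e, r e ^ 2 * (4 * log (∑ f ∈ O e, exp (w f ^ 2 / 4)))) (stdGauss ι) :=
    (integrable_finsetSum _ fun e _ => hki e).const_mul _
  have hint := integral_mono ((hA.sub hB).sub hC)
    (integrable_log_sum_energy T r).integral_prod_right hpt
  rw [integral_prod_symm _ (integrable_log_sum_energy T r)]
  refine le_trans ?_ hint
  rw [integral_sub' (hA.sub hB) hC, integral_sub' hA hB, integral_add (integrable_const _)
    ((integrable_finsetSum _ fun e _ => hvi e).div_const _), integral_const, probReal_univ,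
    one_smul, integral_div, integral_div, integral_const_mul,
    integral_finsetSum _ fun e _ => hvi e]
  simp_rw [integral_const_mul, integral_eval_sq, mul_one]
  gcongr

/-- Adding the self-interaction `∑ r e ^ 2 * (x e * x (g e))` can only increase the quenched
average, since its Gibbs average vanishes after symmetrization over the group. -/
lemma integral_log_sum_energy_le_add_self [DecidableEq ι] :
    ∫ p, log (∑ g, exp (energy T r g p.1 p.2)) ∂(stdGauss ι).prod (stdGauss ι)
      ≤ ∫ p, log (∑ g, exp (∑ e, r e ^ 2 * (p.1 e * p.1 (T g e)) + energy T r g p.1 p.2))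
        ∂(stdGauss ι).prod (stdGauss ι) := by
  set P := (stdGauss ι).prod (stdGauss ι) with hP
  set m : G → (ι → ℝ) → ℝ := fun g x => ∑ e, r e ^ 2 * (x e * x (T g e)) with hm
  have hmm : ∀ g, Measurable (m g) := fun g => by
    simp only [hm]
    fun_prop
  have hmi : ∀ g, Integrable (fun p : (ι → ℝ) × (ι → ℝ) => m g p.1) P := fun g =>
    (integrable_chaos (T g) fun e => r e ^ 2).comp_fst _
  have hm0 : ∀ g, 0 ≤ ∫ p, m g p.1 ∂P := by
    intro g
    rw [hP, integral_fun_fst (f := m g), probReal_univ, one_smul]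
    simp only [hm]
    rw [integral_chaos]
    exact Finset.sum_nonneg fun e _ => sq_nonneg _
  have hperm : ∀ k : G, MeasurePreserving
      (fun p : (ι → ℝ) × (ι → ℝ) => (p.1, fun e => p.2 (T k e))) P P := fun k =>
    (MeasurePreserving.id _).prod (measurePreserving_comp_equiv (T k))
  set Φ : (ι → ℝ) × (ι → ℝ) → ℝ := fun p => log (∑ g, exp (m g p.1 + energy T r g p.1 p.2)) with hΦ
  have hΦm : Measurable Φ := by
    have h1 : ∀ g, Measurable fun p : (ι → ℝ) × (ι → ℝ) => m g p.1 :=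
      fun g => (hmm g).comp measurable_fst
    have h2 := measurable_energy T r
    simp only [hΦ]
    refine (Finset.measurable_sum _ fun g _ => ((h1 g).add (h2 g)).exp).log
  have hΦi : Integrable Φ P := by
    refine integrable_log_sum_exp (fun g => ?_) fun g => (hmi g).add (integrable_energy T r g)
    exact ((hmm g).comp measurable_fst).add (measurable_energy T r g)
  have hΦk : ∀ k : G, ∫ p, Φ (p.1, fun e => p.2 (T k e)) ∂P = ∫ p, Φ p ∂P := by
    intro k
    conv_rhs => rw [← (hperm k).map_eq]
    rw [integral_map (hperm k).aemeasurable hΦm.aestronglyMeasurable]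
  have hΦki : ∀ k : G, Integrable (fun p : (ι → ℝ) × (ι → ℝ) => Φ (p.1, fun e => p.2 (T k e))) P :=
    fun k => (hperm k).integrable_comp_of_integrable hΦi
  clear_value m
  have hN : (0 : ℝ) < Fintype.card G := by exact_mod_cast Fintype.card_pos
  have hpt : ∀ p : (ι → ℝ) × (ι → ℝ),
      Fintype.card G * log (∑ g, exp (energy T r g p.1 p.2)) + ∑ g, m g p.1
        ≤ ∑ k : G, Φ (p.1, fun e => p.2 (T k e)) := by
    intro p
    set S := ∑ g, exp (energy T r g p.1 p.2) with hS
    have hS0 : 0 < S := sum_exp_pos _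
    have hSk : ∀ k : G, ∑ g, exp (energy T r (k * g) p.1 p.2) = S := fun k =>
      Equiv.sum_comp (Equiv.mulLeft k) fun g => exp (energy T r g p.1 p.2)
    have hk : ∀ k : G, log S + ∑ g, exp (energy T r (k * g) p.1 p.2) / S * m g p.1
        ≤ Φ (p.1, fun e => p.2 (T k e)) := by
      intro k
      have h := log_sum_exp_add_ge (fun g => energy T r (k * g) p.1 p.2) fun g => m g p.1
      simp only [hSk] at h
      simpa only [hΦ, energy_permute] using h
    refine le_trans (le_of_eq ?_) (Finset.sum_le_sum fun k _ => hk k)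
    rw [Finset.sum_add_distrib, Finset.sum_const, card_univ, nsmul_eq_mul, Finset.sum_comm]
    congr 1
    refine Finset.sum_congr rfl fun g _ => ?_
    rw [← Finset.sum_mul, ← Finset.sum_div]
    have h : ∑ k, exp (energy T r (k * g) p.1 p.2) = S :=
      Equiv.sum_comp (Equiv.mulRight g) fun k => exp (energy T r k p.1 p.2)
    rw [h, div_self hS0.ne', one_mul]
  have hint := integral_mono (((integrable_log_sum_energy T r).const_mul _).add
    (integrable_finsetSum _ fun g _ => hmi g)) (integrable_finsetSum _ fun k _ => hΦki k) hpt
  simp only [Pi.add_apply] at hint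
  rw [integral_add ((integrable_log_sum_energy T r).const_mul _)
    (integrable_finsetSum _ fun g _ => hmi g), integral_const_mul,
    integral_finsetSum _ fun g _ => hmi g, integral_finsetSum _ fun k _ => hΦki k] at hint
  simp_rw [hΦk] at hint
  rw [Finset.sum_const, card_univ, nsmul_eq_mul] at hint
  have hsum : 0 ≤ ∑ g, ∫ p, m g p.1 ∂P := Finset.sum_nonneg fun g _ => hm0 g
  refine le_of_mul_le_mul_left ?_ hN
  linarith

/-- Lower bound for the quenched average of the partition function of the planted model. -/
theorem integral_log_sum_planted_ge [DecidableEq ι] (hr : ∀ g e, r (T g e) = r e)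
    (hr4 : ∀ e, r e ^ 2 ≤ 1 / 4) {O : ι → Finset ι} (hO : ∀ g e, T g e ∈ O e) {D : ℝ}
    (hD : ∀ e, (#(O e) : ℝ) ≤ D) {s : ℝ} (hs0 : 0 < s) (hs1 : s ≤ 1) :
    log (Fintype.card G) - (∑ e, r e ^ 2) / 2
      - log (4 * ((∑ g, exp (∑ e with T g e = e, r e ^ 2 + 4 * ∑ e, (r e ^ 2) ^ 2))
          / Fintype.card G) + 2) / s
      - s * (4 * log (√2 * D) * ∑ e, r e ^ 2)
      ≤ ∫ p, log (∑ g, exp (∑ e, (r e ^ 2 * (p.1 e * p.1 (T g e) - p.1 e ^ 2)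
          + r e * (p.1 e * p.2 (T g e) - p.1 e * p.2 e)))) ∂(stdGauss ι).prod (stdGauss ι) := by
  set P := (stdGauss ι).prod (stdGauss ι) with hP
  set q : (ι → ℝ) × (ι → ℝ) → ℝ := fun p => ∑ e, (r e ^ 2 * p.1 e ^ 2 + r e * (p.1 e * p.2 e))
    with hq
  have hsqi : ∀ e, Integrable (fun p : (ι → ℝ) × (ι → ℝ) => r e ^ 2 * p.1 e ^ 2) P := fun e =>
    ((memLp_eval e).integrable_sq.const_mul (r e ^ 2)).comp_fst _
  have hmuli : ∀ e, Integrable (fun p : (ι → ℝ) × (ι → ℝ) => r e * (p.1 e * p.2 e)) P := fun e =>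
    ((integrable_eval e).mul_prod (integrable_eval e)).const_mul _
  have hadd : ∀ e, Integrable (fun p : (ι → ℝ) × (ι → ℝ) =>
      r e ^ 2 * p.1 e ^ 2 + r e * (p.1 e * p.2 e)) P := fun e => (hsqi e).add (hmuli e)
  have hqi : Integrable q P := integrable_finsetSum _ fun e _ => hadd e
  have hqint : ∫ p, q p ∂P = ∑ e, r e ^ 2 := by
    simp only [hq]
    rw [integral_finsetSum _ fun e _ => hadd e]
    refine Finset.sum_congr rfl fun e _ => ?_
    rw [integral_add (hsqi e) (hmuli e), integral_const_mul, hP,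
      integral_fun_fst (f := fun x : ι → ℝ => x e ^ 2), integral_const_mul,
      integral_prod_mul (fun x : ι → ℝ => x e) (fun x : ι → ℝ => x e),
      integral_eval_sq, integral_eval]
    simp
  have hsplit : ∀ p : (ι → ℝ) × (ι → ℝ),
      log (∑ g, exp (∑ e, (r e ^ 2 * (p.1 e * p.1 (T g e) - p.1 e ^ 2)
          + r e * (p.1 e * p.2 (T g e) - p.1 e * p.2 e))))
        = log (∑ g, exp (∑ e, r e ^ 2 * (p.1 e * p.1 (T g e)) + energy T r g p.1 p.2)) - q p := by
    intro p
    rw [eq_sub_iff_add_eq, ← log_exp (q p), ← log_mul (sum_exp_pos _).ne' (exp_pos _).ne',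
      Finset.sum_mul]
    simp_rw [← exp_add, hq, energy, ← Finset.sum_add_distrib]
    refine congrArg log (Finset.sum_congr rfl fun g _ => congrArg exp ?_)
    exact Finset.sum_congr rfl fun e _ => by ring
  have hi : Integrable (fun p : (ι → ℝ) × (ι → ℝ) =>
      log (∑ g, exp (∑ e, r e ^ 2 * (p.1 e * p.1 (T g e)) + energy T r g p.1 p.2))) P := by
    refine integrable_log_sum_exp (fun g => ?_) fun g =>
      ((integrable_chaos (T g) fun e => r e ^ 2).comp_fst _).add (integrable_energy T r g)
    have := measurable_energy T r g
    fun_prop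
  simp_rw [hsplit]
  rw [integral_sub hi hqi, hqint]
  have h1 := integral_log_sum_energy_prod_ge hr hr4 hO hD hs0 hs1
  have h2 := integral_log_sum_energy_le_add_self (T := T) (r := r)
  linarith

end GroupAction

section FixedPoints

variable {α : Type*} [Fintype α] [DecidableEq α]

lemma card_perm_fixing (S : Finset α) :
    #{φ : Equiv.Perm α | ∀ i ∈ S, φ i = i} = (Fintype.card α - #S).factorial := by
  rw [← Fintype.card_subtype]
  have e := Equiv.Perm.subtypeEquivSubtypePerm fun i => i ∉ S
  simp only [not_not] at e
  rw [← Fintype.card_congr e, Fintype.card_perm, Fintype.card_subtype_compl, Fintype.card_coe]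

/-- The number of fixed points of a uniform random permutation has Poisson-like moments. -/
lemma sum_pow_card_fixed_le {x : ℝ} (hx : 0 ≤ x) :
    ∑ φ : Equiv.Perm α, x ^ #{i | φ i = i} ≤ (Fintype.card α).factorial * exp x := by
  have h1 : ∀ φ : Equiv.Perm α, x ^ #{i | φ i = i}
      ≤ ∑ S : Finset α, if ∀ i ∈ S, φ i = i then x ^ #S else 0 := by
    intro φ
    rw [← Finset.sum_filter]
    exact Finset.single_le_sum (f := fun S : Finset α => x ^ #S) (fun _ _ => by positivity)
      (by simp)
  calc ∑ φ : Equiv.Perm α, x ^ #{i | φ i = i}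
      ≤ ∑ φ : Equiv.Perm α, ∑ S : Finset α, if ∀ i ∈ S, φ i = i then x ^ #S else 0 :=
        Finset.sum_le_sum fun φ _ => h1 φ
    _ = ∑ S : Finset α, (Fintype.card α - #S).factorial * x ^ #S := by
        rw [Finset.sum_comm]
        refine Finset.sum_congr rfl fun S _ => ?_
        rw [← Finset.sum_filter, Finset.sum_const, card_perm_fixing, nsmul_eq_mul]
    _ = ∑ k ∈ range (Fintype.card α + 1), (Fintype.card α).factorial * (x ^ k / k.factorial) := by
        rw [← Finset.powerset_univ, Finset.sum_powerset_apply_card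
          fun k => ((Fintype.card α - k).factorial : ℝ) * x ^ k]
        rw [card_univ]
        refine Finset.sum_congr rfl fun k hk => ?_
        have h := Nat.choose_mul_factorial_mul_factorial (Nat.lt_succ_iff.1 (mem_range.1 hk))
        have h' : ((Fintype.card α).choose k : ℝ) * k.factorial * (Fintype.card α - k).factorial
            = (Fintype.card α).factorial := by exact_mod_cast h
        rw [← h', nsmul_eq_mul]
        field_simp
    _ ≤ (Fintype.card α).factorial * exp x := by
        rw [← Finset.mul_sum]
        gcongr
        exact sum_le_exp_of_nonneg hx _

/-- An unordered pair fixed by a permutation consists of two fixed points or of a transposed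
pair. -/
lemma card_fixed_pairs_le (φ : Equiv.Perm α) :
    2 * #{z : Sym2 α | ¬z.IsDiag ∧ z.map φ = z} ≤
      #{i | φ i = i} * Fintype.card α + Fintype.card α := by
  set S : Finset (Sym2 α) := {z | ¬z.IsDiag ∧ z.map φ = z} with hS
  set O : Finset (α × α) := {p | s(p.1, p.2) ∈ S} with hO
  have h1 : 2 * #S ≤ #O := by
    refine Finset.mul_card_image_le_card_of_maps_to (f := fun p : α × α => s(p.1, p.2))
      (fun p hp => (mem_filter.1 hp).2) 2 fun z hz => ?_
    induction z with
    | _ i j =>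
      have hij : i ≠ j := by simpa using (mem_filter.1 hz).2.1
      rw [← card_pair (a := (i, j)) (b := (j, i)) (by simp [hij])]
      refine card_le_card fun p hp => ?_
      rw [mem_insert, mem_singleton] at hp
      rcases hp with rfl | rfl
      · simp [hz]
      · simp [hz, Sym2.eq_swap (a := j)]
  have h2 : O ⊆ ({i | φ i = i} : Finset α) ×ˢ univ ∪ univ.image fun i : α => (i, φ i) := by
    rintro ⟨i, j⟩ hp
    simp only [hO, hS, mem_filter, mem_univ, true_and, Sym2.map_mk, Sym2.eq_iff] at hp
    simp only [mem_union, mem_product, mem_filter, mem_univ, true_and, and_true, mem_image,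
      Prod.mk.injEq, exists_eq_left]
    tauto
  calc 2 * #S ≤ #O := h1
    _ ≤ _ := card_le_card h2
    _ ≤ _ := card_union_le _ _
    _ ≤ _ := by
      rw [card_product, card_univ]
      gcongr
      exact card_image_le

end FixedPoints

section Transfer

lemma measurePreserving_comp_injective {ι κ : Type*} [Fintype ι] [Fintype κ] {j : ι → κ}
    (hj : Function.Injective j) :
    MeasurePreserving (fun (x : κ → ℝ) e => x (j e)) (stdGauss κ) (stdGauss ι) := by
  refine ⟨by fun_prop, (Measure.pi_eq fun s hs => ?_).symm⟩
  have hpre : (fun (x : κ → ℝ) e => x (j e)) ⁻¹' Set.univ.pi s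
      = Set.univ.pi (Function.extend j s fun _ => Set.univ) := by
    ext x
    simp only [Set.mem_preimage, Set.mem_univ_pi]
    constructor
    · intro h k
      by_cases hk : ∃ e, j e = k
      · obtain ⟨e, rfl⟩ := hk
        rw [hj.extend_apply]
        exact h e
      · rw [Function.extend_apply' _ _ _ hk]
        trivial
    · intro h e
      have := h (j e)
      rwa [hj.extend_apply] at this
  rw [Measure.map_apply (by fun_prop) (MeasurableSet.univ_pi hs), hpre, stdGauss, Measure.pi_pi]
  refine (Fintype.prod_of_injective j hj _ _ (fun k hk => ?_) fun e => ?_).symm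
  · rw [Function.extend_apply' _ _ _ hk, measure_univ]
  · rw [hj.extend_apply]

lemma measurePreserving_uncurry {α β : Type*} [Fintype α] [Fintype β] :
    MeasurePreserving (fun (f : α → β → ℝ) (p : α × β) => f p.1 p.2)
      (Measure.pi fun _ => Measure.pi fun _ => gaussianReal 0 1) (stdGauss (α × β)) := by
  refine ⟨by fun_prop, (Measure.pi_eq fun s hs => ?_).symm⟩
  have hpre : (fun (f : α → β → ℝ) (p : α × β) => f p.1 p.2) ⁻¹' Set.univ.pi s
      = Set.univ.pi fun a => Set.univ.pi fun b => s (a, b) := by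
    ext x
    simp [Set.mem_pi]
  rw [Measure.map_apply (by fun_prop) (MeasurableSet.univ_pi hs), hpre, Measure.pi_pi,
    Fintype.prod_prod_type]
  simp_rw [Measure.pi_pi]

lemma measurePreserving_sumElim {α β : Type*} [Fintype α] [Fintype β] :
    MeasurePreserving (fun p : (α → ℝ) × (β → ℝ) => (Sum.elim p.1 p.2 : α ⊕ β → ℝ))
      ((stdGauss α).prod (stdGauss β)) (stdGauss (α ⊕ β)) := by
  have h := measurePreserving_sumPiEquivProdPi_symm (fun _ : α ⊕ β => gaussianReal 0 1)
  refine (congrArg (fun f => MeasurePreserving f _ _) (funext fun p => ?_)).mp h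
  ext e
  cases e <;> rfl

lemma measurePreserving_sum_split {α : Type*} [Fintype α] :
    MeasurePreserving (fun x : α ⊕ α → ℝ => ((fun e => x (.inl e), fun e => x (.inr e)) :
      (α → ℝ) × (α → ℝ))) (stdGauss (α ⊕ α)) ((stdGauss α).prod (stdGauss α)) :=
  measurePreserving_sumPiEquivProdPi (fun _ : α ⊕ α => gaussianReal 0 1)

variable {n d : ℕ}

/-- The independent coordinates of the model: unordered pairs of vertices and features. -/
abbrev Coord (n d : ℕ) := Sym2 (Fin n) ⊕ (Fin n × Fin d)

/-- The independent coordinates as a function of a vertex array and of a feature array. -/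
def coords (f : GW n) (x : FW n d) : Coord n d → ℝ :=
  Sum.elim (fun z => f z.inf z.sup) fun p => x p.1 p.2

lemma inf_sup_injective : Function.Injective fun z : Sym2 (Fin n) => (z.inf, z.sup) := by
  intro z w h
  rw [Prod.mk.injEq] at h
  exact Sym2.inf_eq_inf_and_sup_eq_sup.1 h

lemma coords_pair (f : GW n) (x : FW n d) (i j : Fin n) :
    coords f x (.inl s(i, j)) = sym f i j := by
  rw [coords, Sum.elim_inl, Sym2.inf_mk, Sym2.sup_mk, sym]
  split_ifs with h
  · rw [inf_eq_left.2 h, sup_eq_right.2 h]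
  · rw [inf_eq_right.2 (not_le.1 h).le, sup_eq_left.2 (not_le.1 h).le]

instance (n : ℕ) : IsProbabilityMeasure (stdGaussG n) := by
  unfold stdGaussG
  infer_instance

instance (n d : ℕ) : IsProbabilityMeasure (stdGaussF n d) := by
  unfold stdGaussF
  infer_instance

lemma measurePreserving_coords :
    MeasurePreserving (fun ω : Samp n d => (coords ω.1.1 ω.2.1, coords ω.1.2 ω.2.2)) (μ n d)
      ((stdGauss (Coord n d)).prod (stdGauss (Coord n d))) := by
  have hG : MeasurePreserving (fun (f : GW n) (p : Fin n × Fin n) => f p.1 p.2) (stdGaussG n)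
      (stdGauss (Fin n × Fin n)) := measurePreserving_uncurry
  have hF : MeasurePreserving (fun (f : FW n d) (p : Fin n × Fin d) => f p.1 p.2) (stdGaussF n d)
      (stdGauss (Fin n × Fin d)) := measurePreserving_uncurry
  have hGG := measurePreserving_sumElim.comp (hG.prod hG)
  have hFF := measurePreserving_sumElim.comp (hF.prod hF)
  have hall := measurePreserving_sumElim.comp (hGG.prod hFF)
  let j : Coord n d ⊕ Coord n d →
      ((Fin n × Fin n) ⊕ (Fin n × Fin n)) ⊕ ((Fin n × Fin d) ⊕ (Fin n × Fin d)) :=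
    Sum.elim (Sum.elim (fun z => .inl (.inl (z.inf, z.sup))) fun p => .inr (.inl p))
      (Sum.elim (fun z => .inl (.inr (z.inf, z.sup))) fun p => .inr (.inr p))
  have hj : Function.Injective j := by
    have h := inf_sup_injective (n := n)
    rintro ((z | p) | (z | p)) ((w | q) | (w | q)) hzw <;>
      simp only [j, Sum.elim_inl, Sum.elim_inr, Sum.inl.injEq, Sum.inr.injEq, reduceCtorEq]
        at hzw ⊢
    · exact h hzw
    · exact hzw
    · exact h hzw
    · exact hzw
  have := measurePreserving_sum_split.comp ((measurePreserving_comp_injective hj).comp hall)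
  refine (congrArg (fun f => MeasurePreserving f _ _) (funext fun ω => ?_)).mp this
  refine Prod.ext (funext fun e => ?_) (funext fun e => ?_) <;> cases e <;> rfl

/-- The action of vertex permutations on the coordinates. -/
def coordPerm (n d : ℕ) : Equiv.Perm (Fin n) →* Equiv.Perm (Coord n d) where
  toFun φ :=
    { toFun := Sum.map (Sym2.map φ) (Prod.map φ id)
      invFun := Sum.map (Sym2.map φ.symm) (Prod.map φ.symm id)
      left_inv := by
        rintro (z | ⟨i, k⟩)
        · simp [Sym2.map_map]
        · simp
      right_inv := by
        rintro (z | ⟨i, k⟩)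
        · simp [Sym2.map_map]
        · simp }
  map_one' := by
    ext (z | ⟨i, k⟩) <;> simp
  map_mul' φ ψ := by
    ext (z | ⟨i, k⟩) <;> simp [Sym2.map_map]

/-- The interaction strengths of the coordinates. -/
def strength (n d : ℕ) (ρ η : ℝ) : Coord n d → ℝ :=
  Sum.elim (fun z => if z.IsDiag then 0 else ρ / √(1 - ρ ^ 2)) fun _ => η / √(1 - η ^ 2)

lemma strength_coordPerm (ρ η : ℝ) (φ : Equiv.Perm (Fin n)) (e : Coord n d) :
    strength n d ρ η (coordPerm n d φ e) = strength n d ρ η e := by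
  rcases e with z | ⟨i, k⟩
  · simp [strength, coordPerm, Sym2.isDiag_map φ.injective]
  · simp [strength, coordPerm]

lemma sum_sym2_off_diag (g : Sym2 (Fin n) → ℝ) (hg : ∀ z, z.IsDiag → g z = 0) :
    ∑ z, g z = ∑ p : Fin n × Fin n with p.1 < p.2, g s(p.1, p.2) := by
  rw [← Finset.sum_filter_of_ne (p := fun z : Sym2 (Fin n) => ¬z.IsDiag)
    fun z _ hz hd => hz (hg z hd)]
  symm
  refine Finset.sum_bij' (fun p _ => s(p.1, p.2)) (fun z _ => (z.inf, z.sup)) ?_ ?_ ?_ ?_ ?_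
  · intro p hp
    simpa using (mem_filter.1 hp).2.ne
  · intro z hz
    induction z with
    | _ i j => simpa [eq_comm] using hz
  · intro p hp
    have h := (mem_filter.1 hp).2.le
    simp [h]
  · intro z _
    exact inf_sup_injective (by simp [z.inf_le_sup])
  · intro p _
    rfl

lemma neg_V_eq {ρ η : ℝ} (hρ : ρ ^ 2 ≤ 1) (hη : η ^ 2 ≤ 1) (φ : Equiv.Perm (Fin n))
    (ω : Samp n d) :
    -V ρ η φ ω = ∑ e, (strength n d ρ η e ^ 2 *
        (coords ω.1.1 ω.2.1 e * coords ω.1.1 ω.2.1 (coordPerm n d φ e)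
          - coords ω.1.1 ω.2.1 e ^ 2)
      + strength n d ρ η e * (coords ω.1.1 ω.2.1 e * coords ω.1.2 ω.2.2 (coordPerm n d φ e)
          - coords ω.1.1 ω.2.1 e * coords ω.1.2 ω.2.2 e)) := by
  have key : ∀ {c : ℝ}, c ^ 2 ≤ 1 → c / (1 - c ^ 2) * c = (c / √(1 - c ^ 2)) ^ 2 ∧
      c / (1 - c ^ 2) * √(1 - c ^ 2) = c / √(1 - c ^ 2) := by
    intro c hc
    constructor
    · rw [div_pow, sq_sqrt (by linarith)]
      ring
    · rw [div_mul_eq_mul_div, mul_div_assoc, sqrt_div_self, ← div_eq_mul_inv]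
  rw [Fintype.sum_sum_type, sum_sym2_off_diag, V, neg_add]
  · congr 1
    · rw [← Finset.sum_subset (s₁ := movedEdges φ)]
      · rw [VGstar, VG, ← Finset.sum_sub_distrib, Finset.mul_sum, ← Finset.sum_neg_distrib]
        refine Finset.sum_congr rfl fun p hp => ?_
        have hne : p.1 ≠ p.2 := (mem_filter.1 hp).2.1.ne
        have hr : strength n d ρ η (.inl s(p.1, p.2)) = ρ / √(1 - ρ ^ 2) := by
          simp [strength, hne]
        have hT : coordPerm n d φ (.inl s(p.1, p.2)) = .inl s(φ p.1, φ p.2) := rfl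
        rw [hr, hT, coords_pair, coords_pair, coords_pair, coords_pair, ← (key hρ).1]
        conv_rhs => rw [← (key hρ).2]
        simp only [Bmat, Amat]
        ring
      · intro p hp
        simp only [movedEdges, mem_filter, mem_univ, true_and] at hp ⊢
        exact hp.1
      · intro p hp hpm
        simp only [movedEdges, mem_filter, mem_univ, true_and, not_and, not_not] at hp hpm
        have hT : coordPerm n d φ (.inl s(p.1, p.2)) = .inl s(p.1, p.2) := by
          refine congrArg Sum.inl ?_
          rw [Sym2.map_mk, Sym2.eq_iff]
          exact hpm hp
        rw [hT]
        ring
    · rw [Fintype.sum_prod_type, ← Finset.sum_subset (Finset.subset_univ φ.support)]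
      · rw [VFstar, VF, ← Finset.sum_sub_distrib, Finset.mul_sum, ← Finset.sum_neg_distrib]
        refine Finset.sum_congr rfl fun i _ => ?_
        rw [← Finset.sum_sub_distrib, Finset.mul_sum, ← Finset.sum_neg_distrib]
        refine Finset.sum_congr rfl fun k _ => ?_
        have hr : strength n d ρ η (.inr (i, k)) = η / √(1 - η ^ 2) := rfl
        have hT : coordPerm n d φ (.inr (i, k)) = .inr (φ i, k) := rfl
        have hc : ∀ (f : GW n) (x : FW n d) (i : Fin n) (k : Fin d),
          coords f x (.inr (i, k)) = x i k := fun _ _ _ _ => rfl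
        rw [hr, hT, hc, hc, hc, hc, ← (key hη).1]
        conv_rhs => rw [← (key hη).2]
        simp only [Ymat, Xmat]
        ring
      · intro i _ hi
        refine Finset.sum_eq_zero fun k _ => ?_
        have hT : coordPerm n d φ (.inr (i, k)) = .inr (i, k) :=
          congrArg (fun i => Sum.inr (i, k)) (Equiv.Perm.notMem_support.1 hi)
        rw [hT]
        ring
  · intro z hz
    simp [strength, hz]

end Transfer

section FiniteSize

variable {n d : ℕ} {ρ η a b κ L s : ℝ}

lemma strength_inl_sq (hρ : ρ ^ 2 ≤ 1) (z : Sym2 (Fin n)) :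
    strength n d ρ η (.inl z) ^ 2 = if z.IsDiag then 0 else ρ ^ 2 / (1 - ρ ^ 2) := by
  simp only [strength, Sum.elim_inl]
  split_ifs
  · simp
  · rw [div_pow, sq_sqrt (by linarith)]

lemma strength_inr_sq (hη : η ^ 2 ≤ 1) (p : Fin n × Fin d) :
    strength n d ρ η (.inr p) ^ 2 = η ^ 2 / (1 - η ^ 2) := by
  simp only [strength, Sum.elim_inr]
  rw [div_pow, sq_sqrt (by linarith)]

lemma sum_strength_sq_fixed_le (hρ : ρ ^ 2 ≤ 1) (hη : η ^ 2 ≤ 1)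
    (hL : ρ ^ 2 / (1 - ρ ^ 2) * n / 2 + η ^ 2 / (1 - η ^ 2) * d ≤ L) (φ : Equiv.Perm (Fin n)) :
    ∑ e with coordPerm n d φ e = e, strength n d ρ η e ^ 2 ≤ (#{i | φ i = i} + 1) * L := by
  have ha : 0 ≤ ρ ^ 2 / (1 - ρ ^ 2) := div_nonneg (sq_nonneg _) (by linarith)
  have hb : 0 ≤ η ^ 2 / (1 - η ^ 2) := div_nonneg (sq_nonneg _) (by linarith)
  set a := ρ ^ 2 / (1 - ρ ^ 2) with ha'
  set b := η ^ 2 / (1 - η ^ 2) with hb'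
  have hG : ∑ z : Sym2 (Fin n), (if coordPerm n d φ (.inl z) = .inl z then
      strength n d ρ η (.inl z) ^ 2 else 0)
        = #{z : Sym2 (Fin n) | ¬z.IsDiag ∧ z.map φ = z} * a := by
    rw [← nsmul_eq_mul, ← Finset.sum_const, Finset.sum_filter]
    refine Finset.sum_congr rfl fun z _ => ?_
    have hT : coordPerm n d φ (.inl z) = .inl (z.map φ) := rfl
    simp only [hT, Sum.inl.injEq, strength_inl_sq hρ, ite_and, ite_not, ← ha']
    split_ifs <;> rfl
  have hF : ∑ p : Fin n × Fin d, (if coordPerm n d φ (.inr p) = .inr p then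
      strength n d ρ η (.inr p) ^ 2 else 0) = #{i | φ i = i} * (d * b) := by
    rw [Fintype.sum_prod_type, ← nsmul_eq_mul, ← Finset.sum_const, Finset.sum_filter]
    refine Finset.sum_congr rfl fun i _ => ?_
    have hT : ∀ k, coordPerm n d φ (.inr (i, k)) = .inr (φ i, k) := fun _ => rfl
    simp only [hT, Sum.inr.injEq, Prod.mk.injEq, and_true, strength_inr_sq hη, ← hb']
    split_ifs <;> simp
  have hc : 2 * (#{z : Sym2 (Fin n) | ¬z.IsDiag ∧ z.map φ = z} : ℝ)
      ≤ #{i | φ i = i} * n + n := by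
    have := card_fixed_pairs_le φ
    rw [Fintype.card_fin] at this
    exact_mod_cast this
  rw [Finset.sum_filter, Fintype.sum_sum_type, hG, hF]
  have h1 := mul_le_mul_of_nonneg_right hc ha
  have hf : (0 : ℝ) ≤ #{i | φ i = i} := Nat.cast_nonneg _
  have hbd : 0 ≤ b * d := by positivity
  have h2 := mul_le_mul_of_nonneg_left hL hf
  nlinarith

lemma sum_strength_sq_le (hρ : ρ ^ 2 ≤ 1) (hη : η ^ 2 ≤ 1)
    (hL : ρ ^ 2 / (1 - ρ ^ 2) * n / 2 + η ^ 2 / (1 - η ^ 2) * d ≤ L) :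
    ∑ e, strength n d ρ η e ^ 2 ≤ (n + 1) * L := by
  simpa using sum_strength_sq_fixed_le hρ hη hL 1

lemma card_sym2_fin_le (n : ℕ) : Fintype.card (Sym2 (Fin n)) ≤ n ^ 2 := by
  refine (Fintype.card_le_of_injective _ inf_sup_injective).trans ?_
  simp [sq]

/-- A lower bound on the expected log-partition function at finite size. -/
theorem integral_log_Zpart_ge (hρ : ρ ^ 2 ≤ 1) (hη : η ^ 2 ≤ 1) (hn : 1 ≤ n)
    (haκ : ρ ^ 2 / (1 - ρ ^ 2) ≤ κ) (hbκ : η ^ 2 / (1 - η ^ 2) ≤ κ) (hκ : κ ≤ 1 / 4)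
    (hL : ρ ^ 2 / (1 - ρ ^ 2) * n / 2 + η ^ 2 / (1 - η ^ 2) * d ≤ L)
    (hs0 : 0 < s) (hs1 : s ≤ 1) :
    log n.factorial - (n + 1) * L / 2 - (4 * κ * ((n + 1) * L) + L + exp L + 2) / s
        - s * (4 * log (√2 * n ^ 2) * ((n + 1) * L)) ≤ ∫ ω, log (Zpart ρ η ω) ∂μ n d := by
  have ha : 0 ≤ ρ ^ 2 / (1 - ρ ^ 2) := div_nonneg (sq_nonneg _) (by linarith)
  have hb : 0 ≤ η ^ 2 / (1 - η ^ 2) := div_nonneg (sq_nonneg _) (by linarith)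
  have hL0 : 0 ≤ L := le_trans (by positivity) hL
  have hκ0 : 0 ≤ κ := ha.trans haκ
  have hn' : (1 : ℝ) ≤ n := by exact_mod_cast hn
  have hrκ : ∀ e, strength n d ρ η e ^ 2 ≤ κ := by
    rintro (z | p)
    · rw [strength_inl_sq hρ]
      split_ifs
      exacts [hκ0, haκ]
    · rwa [strength_inr_sq hη]
  let O : Coord n d → Finset (Coord n d) := Sum.elim (fun _ => univ.image Sum.inl)
    fun p => univ.image fun i => Sum.inr (i, p.2)
  have hO : ∀ φ e, coordPerm n d φ e ∈ O e := by
    rintro φ (z | ⟨i, k⟩)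
    · exact mem_image_of_mem Sum.inl (mem_univ (z.map φ))
    · exact mem_image_of_mem (fun i => Sum.inr (i, k)) (mem_univ (φ i))
  have hD : ∀ e, (#(O e) : ℝ) ≤ (n : ℝ) ^ 2 := by
    have hnn : n ≤ n ^ 2 := Nat.le_self_pow two_ne_zero n
    rintro (z | ⟨i, k⟩)
    · exact_mod_cast card_image_le.trans (card_sym2_fin_le n)
    · refine mod_cast card_image_le.trans ?_
      simpa using hnn
  have main := integral_log_sum_planted_ge (strength_coordPerm ρ η)
    (fun e => (hrκ e).trans hκ) hO hD hs0 hs1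
  have htransfer : ∫ ω, log (Zpart ρ η ω) ∂μ n d = ∫ p, log (∑ φ, exp (∑ e,
      (strength n d ρ η e ^ 2 * (p.1 e * p.1 (coordPerm n d φ e) - p.1 e ^ 2)
        + strength n d ρ η e * (p.1 e * p.2 (coordPerm n d φ e) - p.1 e * p.2 e))))
      ∂(stdGauss (Coord n d)).prod (stdGauss (Coord n d)) := by
    rw [← measurePreserving_coords.map_eq, integral_map]
    · simp_rw [Zpart, neg_V_eq hρ hη]
    · exact measurePreserving_coords.measurable.aemeasurable
    · exact Measurable.aestronglyMeasurable (by fun_prop)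
  rw [htransfer]
  refine le_trans ?_ main
  have hS := sum_strength_sq_le hρ hη hL
  have hS0 : 0 ≤ ∑ e, strength n d ρ η e ^ 2 := Finset.sum_nonneg fun e _ => sq_nonneg _
  have hS4 : ∑ e, (strength n d ρ η e ^ 2) ^ 2 ≤ κ * ((n + 1) * L) := by
    refine le_trans ?_ (mul_le_mul_of_nonneg_left hS hκ0)
    rw [Finset.mul_sum]
    refine Finset.sum_le_sum fun e _ => ?_
    rw [sq]
    exact mul_le_mul_of_nonneg_right (hrκ e) (sq_nonneg _)
  set t := 4 * κ * ((n + 1) * L) + L + exp L with ht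
  have ht0 : 0 ≤ t := by positivity
  have hmom : (∑ φ, exp (∑ e with coordPerm n d φ e = e, strength n d ρ η e ^ 2
      + 4 * ∑ e, (strength n d ρ η e ^ 2) ^ 2)) / Fintype.card (Equiv.Perm (Fin n)) ≤ exp t := by
    rw [Fintype.card_perm, Fintype.card_fin, div_le_iff₀ (by positivity)]
    have h := sum_pow_card_fixed_le (α := Fin n) (exp_pos L).le
    rw [Fintype.card_fin] at h
    calc _ ≤ ∑ φ : Equiv.Perm (Fin n), exp (4 * κ * ((n + 1) * L) + L)
          * exp L ^ #{i | φ i = i} := by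
          refine Finset.sum_le_sum fun φ _ => ?_
          rw [← Real.exp_nat_mul, ← Real.exp_add]
          have := sum_strength_sq_fixed_le hρ hη hL φ
          refine exp_le_exp.2 ?_
          linarith
      _ ≤ exp (4 * κ * ((n + 1) * L) + L) * (n.factorial * exp (exp L)) := by
          rw [← Finset.mul_sum]
          gcongr
      _ = _ := by
          rw [ht, Real.exp_add _ (exp L)]
          ring
  have hlog : log (4 * ((∑ φ, exp (∑ e with coordPerm n d φ e = e, strength n d ρ η e ^ 2
      + 4 * ∑ e, (strength n d ρ η e ^ 2) ^ 2)) / Fintype.card (Equiv.Perm (Fin n))) + 2)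
        ≤ t + 2 := by
    rw [Real.log_le_iff_le_exp (by positivity), Real.exp_add]
    have h1 : 1 ≤ exp t := one_le_exp ht0
    have h2 : 6 ≤ exp (2 : ℝ) := by
      have := Real.exp_one_gt_d9
      rw [show (2 : ℝ) = 1 + 1 by norm_num, Real.exp_add]
      nlinarith
    nlinarith
  have hlogD : 0 ≤ log (√2 * (n : ℝ) ^ 2) := by
    refine log_nonneg (one_le_mul_of_one_le_of_one_le ?_ (one_le_pow₀ hn'))
    rw [one_le_sqrt]
    norm_num
  rw [Fintype.card_perm, Fintype.card_fin]
  have e2 := div_le_div_of_nonneg_right hlog hs0.le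
  have e3 : s * (4 * log (√2 * n ^ 2) * ∑ e, strength n d ρ η e ^ 2)
      ≤ s * (4 * log (√2 * n ^ 2) * ((n + 1) * L)) := by gcongr
  rw [Fintype.card_perm, Fintype.card_fin] at e2
  linarith

end FiniteSize

section Asymptotics

/-- The squared relative error in the lower bound on the expected log-partition function. -/
def errorSq (ε : ℝ) (n d : ℕ) : ℝ :=
  (2 * log n / n + log n / d) * log n + log n / n + (n : ℝ) ^ (-ε)

lemma tendsto_log_pow_div_nat (k : ℕ) :
    Tendsto (fun n : ℕ => log n ^ k / n) atTop (𝓝 0) :=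
  (isLittleO_pow_log_id_atTop (n := k)).tendsto_div_nhds_zero.comp tendsto_natCast_atTop_atTop

lemma tendsto_errorSq {d : ℕ → ℕ} {ε : ℝ} (hε : 0 < ε)
    (hd : Tendsto (fun n : ℕ => (d n : ℝ) / (log n) ^ 2) atTop atTop) :
    Tendsto (fun n => errorSq ε n (d n)) atTop (𝓝 0) := by
  have h1 := (tendsto_log_pow_div_nat 2).const_mul 2
  have h2 := hd.inv_tendsto_atTop
  have h3 := tendsto_log_pow_div_nat 1
  have h4 := (tendsto_rpow_neg_atTop hε).comp (tendsto_natCast_atTop_atTop (R := ℝ))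
  have h := ((h1.add h2).add h3).add h4
  simp only [mul_zero, add_zero] at h
  refine h.congr fun n => ?_
  simp only [errorSq, Pi.inv_apply, inv_div, Function.comp_apply, pow_one]
  ring

lemma integral_log_Zpart_ge_of_errorSq_le {n d : ℕ} {ρ η ε : ℝ} (hρ : ρ ^ 2 ≤ 1) (hη : η ^ 2 ≤ 1)
    (hε : 0 < ε) (hn : 3 ≤ n) (hd : 0 < d) (hψ : errorSq ε n d ≤ 1 / 4)
    (hsig : ρ ^ 2 * n / (1 - ρ ^ 2) + 2 * η ^ 2 * d / (1 - η ^ 2) ≤ 2 * (1 - ε) * log n) :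
    (1 + ε) / 2 * n * log n - n * log n * (1 / log n + 1 / n + 32 * √(errorSq ε n d))
      ≤ ∫ ω, log (Zpart ρ η ω) ∂μ n d := by
  have hn3 : (3 : ℝ) ≤ n := by exact_mod_cast hn
  have hn0 : (0 : ℝ) < n := by linarith
  have hd0 : (0 : ℝ) < d := by exact_mod_cast hd
  have hℓ1 : 1 ≤ log n := by
    rw [le_log_iff_exp_le hn0]
    exact exp_one_lt_three.le.trans hn3
  have ha : 0 ≤ ρ ^ 2 / (1 - ρ ^ 2) := div_nonneg (sq_nonneg _) (by linarith)
  have hb : 0 ≤ η ^ 2 / (1 - η ^ 2) := div_nonneg (sq_nonneg _) (by linarith)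
  have hexp : exp ((1 - ε) * log n) = n * (n : ℝ) ^ (-ε) := by
    rw [rpow_def_of_pos hn0]
    conv_rhs => rw [← exp_log hn0]
    rw [log_exp, ← Real.exp_add]
    ring_nf
  have hsig' : ρ ^ 2 / (1 - ρ ^ 2) * n / 2 + η ^ 2 / (1 - η ^ 2) * d ≤ (1 - ε) * log n := by
    have : ρ ^ 2 / (1 - ρ ^ 2) * n / 2 + η ^ 2 / (1 - η ^ 2) * d
      = (ρ ^ 2 * n / (1 - ρ ^ 2) + 2 * η ^ 2 * d / (1 - η ^ 2)) / 2 := by ring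
    rw [this]
    linarith
  set ℓ := log n with hℓ
  set a := ρ ^ 2 / (1 - ρ ^ 2) with ha'
  set b := η ^ 2 / (1 - η ^ 2) with hb'
  set L := (1 - ε) * ℓ with hLdef
  set κ := 2 * ℓ / n + ℓ / d with hκ
  set ψ := errorSq ε n d with hψdef
  have hpow : 0 < (n : ℝ) ^ (-ε) := rpow_pos_of_pos hn0 _
  have hψeq : ψ = κ * ℓ + ℓ / n + (n : ℝ) ^ (-ε) := rfl
  have hκ0 : 0 ≤ κ := by positivity
  have hψ0 : 0 < ψ := by rw [hψeq]; positivity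
  have hκψ : κ ≤ ψ := by
    have h1 : κ ≤ κ * ℓ := le_mul_of_one_le_right hκ0 hℓ1
    have h2 : 0 ≤ ℓ / n := by positivity
    linarith
  have hL0 : 0 ≤ L := le_trans (by positivity) hsig'
  have hLℓ : L ≤ ℓ := by nlinarith
  have haκ : a ≤ κ := by
    have h1 : a ≤ 2 * ℓ / n := by
      rw [le_div_iff₀ hn0]
      have : 0 ≤ b * d := by positivity
      linarith
    have h2 : 0 ≤ ℓ / d := by positivity
    linarith
  have hbκ : b ≤ κ := by
    have h1 : b ≤ ℓ / d := by
      rw [le_div_iff₀ hd0]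
      have : 0 ≤ a * n / 2 := by positivity
      linarith
    have h2 : 0 ≤ 2 * ℓ / n := by positivity
    linarith
  have hsq : √ψ ^ 2 = ψ := sq_sqrt hψ0.le
  have hsψ0 : 0 < √ψ := sqrt_pos.2 hψ0
  have hs0 : 0 < √ψ / ℓ := by positivity
  have hs1 : √ψ / ℓ ≤ 1 := by
    rw [div_le_one (by linarith)]
    exact (sqrt_le_one.2 (by linarith)).trans hℓ1
  refine le_trans ?_ (integral_log_Zpart_ge hρ hη (by omega) haκ hbκ (hκψ.trans hψ) hsig' hs0 hs1)
  have hfac : n * ℓ - n ≤ log n.factorial := by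
    refine le_trans ?_ (Stirling.le_log_factorial_stirling (by omega))
    have : 0 ≤ log (2 * π) := log_nonneg (by linarith [pi_gt_three])
    linarith
  have hlogD : log (√2 * n ^ 2) ≤ 3 * ℓ := by
    rw [log_mul (by positivity) (by positivity), log_pow]
    have : log √2 ≤ ℓ := by
      refine log_le_log (by positivity) (le_trans ?_ hn3)
      rw [sqrt_le_left (by norm_num)]
      norm_num
    push_cast
    linarith
  have hnL : (n + 1) * L ≤ 2 * (n * ℓ) := by nlinarith
  have hnL0 : 0 ≤ (n + 1) * L := by positivity
  have hmom : (4 * κ * ((n + 1) * L) + L + exp L + 2) / (√ψ / ℓ) ≤ 8 * (n * ℓ * √ψ) := by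
    rw [div_le_iff₀ hs0]
    have e1 : 8 * (n * ℓ * √ψ) * (√ψ / ℓ) = 8 * (n * ψ) := by
      conv_rhs => rw [← hsq]
      field_simp
    have e2 : n * ψ = n * (κ * ℓ) + ℓ + n * (n : ℝ) ^ (-ε) := by
      rw [hψeq]
      field_simp
    have e3 : 4 * κ * ((n + 1) * L) ≤ 4 * κ * (2 * (n * ℓ)) := by gcongr
    have e4 : 0 < n * (n : ℝ) ^ (-ε) := by positivity
    rw [e1, e2, hexp]
    linarith
  have hconc : √ψ / ℓ * (4 * log (√2 * n ^ 2) * ((n + 1) * L)) ≤ 24 * (n * ℓ * √ψ) := by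
    calc _ ≤ √ψ / ℓ * (4 * (3 * ℓ) * (2 * (n * ℓ))) := by gcongr
      _ = _ := by
        field_simp
        ring
  have herr : n * ℓ * (1 / ℓ + 1 / n + 32 * √ψ) = n + ℓ + 32 * (n * ℓ * √ψ) := by
    field_simp
  have hmain : (1 + ε) / 2 * n * ℓ = n * ℓ - n * L / 2 := by
    rw [hLdef]
    ring
  rw [herr, hmain]
  linarith

end Asymptotics

end CGM

open CGM in
/-- **Lower bound on the expected log-partition function (Lemma C.2).**  If
`d = ω((log n)²)` and `ρ²n/(1−ρ²) + 2η²d/(1−η²) ≤ 2(1−ε) log n` for some `ε > 0`, then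
`E[log Z] ≥ ((1+ε)/2) n log n (1+o(1))`. -/
theorem expected_logZ_lower_bound (d : ℕ → ℕ) (ρ η : ℕ → ℝ)
    (hρ : ∀ n, ρ n ∈ Set.Icc (-1 : ℝ) 1) (hη : ∀ n, η n ∈ Set.Icc (-1 : ℝ) 1)
    (hd : Tendsto (fun n : ℕ => (d n : ℝ) / (Real.log n) ^ 2) atTop atTop)
    (ε : ℝ) (hε : 0 < ε)
    (hsig : ∀ᶠ n : ℕ in atTop,
      (ρ n) ^ 2 * n / (1 - (ρ n) ^ 2) + 2 * (η n) ^ 2 * (d n) / (1 - (η n) ^ 2) ≤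
        2 * (1 - ε) * Real.log n) :
    ∃ c : ℕ → ℝ, Tendsto c atTop (𝓝 0) ∧ ∀ᶠ n : ℕ in atTop,
      (1 + ε) / 2 * n * Real.log n * (1 + c n) ≤
        ∫ ω, Real.log (Zpart (ρ n) (η n) ω) ∂μ n (d n) := by
  have hψ := tendsto_errorSq hε hd
  refine ⟨fun n => -(2 / (1 + ε)) * (1 / log n + 1 / n + 32 * √(errorSq ε n (d n))), ?_, ?_⟩
  · have h1 := (tendsto_log_atTop.comp (tendsto_natCast_atTop_atTop (R := ℝ))).inv_tendsto_atTop
    have h2 := (tendsto_natCast_atTop_atTop (R := ℝ)).inv_tendsto_atTop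
    have h3 := hψ.sqrt.const_mul 32
    have h := ((h1.add h2).add h3).const_mul (-(2 / (1 + ε)))
    simp only [sqrt_zero, mul_zero, add_zero] at h
    simpa [Function.comp_def] using h
  · filter_upwards [hsig, hψ.eventually (eventually_le_nhds (by norm_num : (0 : ℝ) < 1 / 4)),
      hd.eventually_gt_atTop 0, eventually_ge_atTop 3] with n hn hψn hdn hn3
    have hd0 : 0 < d n := by
      rcases (d n).eq_zero_or_pos with h | h
      · simp [h] at hdn
      · exact h
    have hsq : ∀ {x : ℝ}, x ∈ Set.Icc (-1 : ℝ) 1 → x ^ 2 ≤ 1 := fun hx =>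
      (sq_le_one_iff_abs_le_one _).2 (abs_le.2 hx)
    refine le_of_eq_of_le ?_
      (integral_log_Zpart_ge_of_errorSq_le (hsq (hρ n)) (hsq (hη n)) hε hn3 hd0 hψn hn)
    field_simp
    ring
end
end

section
/- (Uniform deviation over permutations with a fixed unfixed-point set.) In the Gaussian contextual graph matching model with π* = id, let D ⊆ [n], let P_D := {π ∈ S_n : D_π = D}, and let π̃ be an arbitrary element of P_D. There exist universal constants C, C' > 0 such that whenever ε > C |D| log(|D|), P( ∃ π ∈ P_D : |V*_G(π) − E[V*_G(π)]| > ε ) ≤ P( |V*_G(π̃) − E[V*_G(π̃)]| > ε/2 ) + exp(−C' ε). -/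
open MeasureTheory ProbabilityTheory Real Filter Finset Topology

noncomputable section

namespace CGM

instance inst_s13 (n : ℕ) : IsProbabilityMeasure (stdGaussG n) := by
  unfold stdGaussG; infer_instance

instance inst_s13_2 (n d : ℕ) : IsProbabilityMeasure (stdGaussF n d) := by
  unfold stdGaussF; infer_instance

instance (n d : ℕ) : IsProbabilityMeasure (μ n d) := by
  unfold μ; infer_instance

lemma measurePreserving_stdGaussG_eval (n : ℕ) (i j : Fin n) :
    MeasurePreserving (fun f : GW n => f i j) (stdGaussG n) (gaussianReal 0 1) :=
  (measurePreserving_eval (fun _ : Fin n => gaussianReal 0 1) j).comp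
    (measurePreserving_eval
      (fun _ : Fin n => Measure.pi fun _ : Fin n => gaussianReal 0 1) i)

lemma measurePreserving_weight (n d : ℕ) (i j : Fin n) :
    MeasurePreserving (fun ω : Samp n d => ω.1.1 i j) (μ n d) (gaussianReal 0 1) :=
  (measurePreserving_stdGaussG_eval n i j).comp
    (measurePreserving_fst.comp measurePreserving_fst)

lemma measurePreserving_noise (n d : ℕ) (i j : Fin n) :
    MeasurePreserving (fun ω : Samp n d => ω.1.2 i j) (μ n d) (gaussianReal 0 1) :=
  (measurePreserving_stdGaussG_eval n i j).comp
    (measurePreserving_snd.comp measurePreserving_fst)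

lemma integrable_sq_gaussianReal : Integrable (fun x : ℝ => x ^ 2) (gaussianReal 0 1) :=
  (memLp_id_gaussianReal 2).integrable_sq

lemma integral_sq_gaussianReal : ∫ x, x ^ 2 ∂gaussianReal 0 1 = 1 := by
  have h := variance_of_integral_eq_zero (X := id) (μ := gaussianReal 0 1) (by fun_prop)
    (by simp)
  rw [variance_id_gaussianReal] at h
  simpa using h.symm

lemma one_le_integral_exp_sq {c : ℝ} (hc0 : 0 ≤ c)
    (hc : Integrable (fun x => Real.exp (c * x ^ 2)) (gaussianReal 0 1)) :
    1 ≤ ∫ x, Real.exp (c * x ^ 2) ∂gaussianReal 0 1 := by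
  simpa using integral_mono (integrable_const (1 : ℝ)) hc
    (fun x => Real.one_le_exp (mul_nonneg hc0 (sq_nonneg x)))

/-- Squared length of the pair of independent Gaussians from which the edge `p` is built. -/
def edgeEnergy (p : Fin n × Fin n) (ω : Samp n d) : ℝ :=
  ω.1.1 p.1 p.2 ^ 2 + ω.1.2 p.1 p.2 ^ 2

lemma integrable_edgeEnergy (p : Fin n × Fin n) :
    Integrable (edgeEnergy (d := d) p) (μ n d) :=
  ((measurePreserving_weight n d p.1 p.2).integrable_comp_of_integrable
      integrable_sq_gaussianReal).add
    ((measurePreserving_noise n d p.1 p.2).integrable_comp_of_integrable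
      integrable_sq_gaussianReal)

lemma integral_edgeEnergy (p : Fin n × Fin n) :
    ∫ ω, edgeEnergy (d := d) p ω ∂μ n d = 2 := by
  have key : ∀ X : Samp n d → ℝ, MeasurePreserving X (μ n d) (gaussianReal 0 1) →
      Integrable (fun ω => X ω ^ 2) (μ n d) ∧ ∫ ω, X ω ^ 2 ∂μ n d = 1 := by
    intro X hX
    refine ⟨hX.integrable_comp_of_integrable integrable_sq_gaussianReal, ?_⟩
    rw [← integral_sq_gaussianReal, ← hX.map_eq,
      integral_map hX.measurable.aemeasurable (by fun_prop)]
  obtain ⟨h1, e1⟩ := key _ (measurePreserving_weight n d p.1 p.2)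
  obtain ⟨h2, e2⟩ := key _ (measurePreserving_noise n d p.1 p.2)
  unfold edgeEnergy
  rw [integral_add h1 h2, e1, e2]
  norm_num

lemma abs_mul_le_edgeEnergy {ρ : ℝ} (hρ : ρ ∈ Set.Icc (-1 : ℝ) 1) {p : Fin n × Fin n}
    (hp : p.1 < p.2) (ω : Samp n d) :
    |Bmat ρ ω p.1 p.2 * Amat ω p.1 p.2| ≤ 2 * edgeEnergy p ω := by
  simp only [Bmat, Amat, sym, hp.le, if_true, edgeEnergy]
  generalize ω.1.1 p.1 p.2 = a
  generalize ω.1.2 p.1 p.2 = b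
  have hs0 : 0 ≤ √(1 - ρ ^ 2) := Real.sqrt_nonneg _
  have hs1 : √(1 - ρ ^ 2) ≤ 1 := Real.sqrt_le_one.mpr (by nlinarith [sq_nonneg ρ])
  generalize √(1 - ρ ^ 2) = s at hs0 hs1
  obtain ⟨h1, h2⟩ := hρ
  rw [abs_le]
  constructor <;>
    nlinarith [mul_nonneg hs0 (sq_nonneg (a + b)), mul_nonneg hs0 (sq_nonneg (a - b)),
      mul_nonneg (sub_nonneg.2 hs1) (sq_nonneg a), mul_nonneg (sub_nonneg.2 hs1) (sq_nonneg b),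
      mul_nonneg (sub_nonneg.2 h1) (sq_nonneg a), mul_nonneg (sub_nonneg.2 h2) (sq_nonneg a),
      sq_nonneg a, sq_nonneg b]

lemma measurable_Amat (i j : Fin n) : Measurable fun ω : Samp n d => Amat ω i j := by
  unfold Amat sym
  split_ifs <;> fun_prop

lemma measurable_Bmat (ρ : ℝ) (i j : Fin n) : Measurable fun ω : Samp n d => Bmat ρ ω i j := by
  unfold Bmat
  refine ((measurable_Amat i j).const_mul _).add (Measurable.const_mul ?_ _)
  unfold sym
  split_ifs <;> fun_prop

lemma integrable_edgeProduct {ρ : ℝ} (hρ : ρ ∈ Set.Icc (-1 : ℝ) 1) {p : Fin n × Fin n}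
    (hp : p.1 < p.2) :
    Integrable (fun ω : Samp n d => Bmat ρ ω p.1 p.2 * Amat ω p.1 p.2) (μ n d) :=
  ((integrable_edgeEnergy p).const_mul 2).mono'
    ((measurable_Bmat ρ _ _).mul (measurable_Amat _ _)).aestronglyMeasurable
    (ae_of_all _ fun ω => abs_mul_le_edgeEnergy hρ hp ω)

/-- The centered contribution of the edge `p` to `VGstar`. -/
def centeredEdge (ρ : ℝ) (p : Fin n × Fin n) (ω : Samp n d) : ℝ :=
  Bmat ρ ω p.1 p.2 * Amat ω p.1 p.2 - ∫ ω' : Samp n d, Bmat ρ ω' p.1 p.2 * Amat ω' p.1 p.2 ∂μ n d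

lemma abs_centeredEdge_le {ρ : ℝ} (hρ : ρ ∈ Set.Icc (-1 : ℝ) 1) {p : Fin n × Fin n}
    (hp : p.1 < p.2) (ω : Samp n d) :
    |centeredEdge ρ p ω| ≤ 2 * edgeEnergy p ω + 4 := by
  have h : |∫ ω' : Samp n d, Bmat ρ ω' p.1 p.2 * Amat ω' p.1 p.2 ∂μ n d| ≤ 4 := by
    calc |∫ ω' : Samp n d, Bmat ρ ω' p.1 p.2 * Amat ω' p.1 p.2 ∂μ n d|
        ≤ ∫ ω' : Samp n d, 2 * edgeEnergy p ω' ∂μ n d := by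
          rw [← Real.norm_eq_abs]
          exact norm_integral_le_of_norm_le ((integrable_edgeEnergy p).const_mul 2)
            (ae_of_all _ fun ω => abs_mul_le_edgeEnergy hρ hp ω)
      _ = 4 := by rw [integral_const_mul, integral_edgeEnergy]; norm_num
  exact (abs_sub _ _).trans (add_le_add (abs_mul_le_edgeEnergy hρ hp ω) h)

lemma lt_of_mem_movedEdges {φ : Equiv.Perm (Fin n)} {p : Fin n × Fin n}
    (hp : p ∈ movedEdges φ) : p.1 < p.2 := (Finset.mem_filter.1 hp).2.1

lemma VGstar_sub_integral {ρ : ℝ} (hρ : ρ ∈ Set.Icc (-1 : ℝ) 1) (φ : Equiv.Perm (Fin n))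
    (ω : Samp n d) :
    VGstar ρ φ ω - ∫ ω', VGstar ρ φ ω' ∂μ n d = ∑ p ∈ movedEdges φ, centeredEdge ρ p ω := by
  unfold VGstar centeredEdge
  rw [integral_finsetSum _ fun p hp => integrable_edgeProduct hρ (lt_of_mem_movedEdges hp),
    Finset.sum_sub_distrib]

/-- Edges moved by one permutation but not by another with the same support are transposed by
the latter, so there are at most as many of them as there are moved points. -/
lemma card_movedEdges_sdiff_le {φ ψ : Equiv.Perm (Fin n)} (h : φ.support = ψ.support) :
    #(movedEdges φ \ movedEdges ψ) ≤ #ψ.support := by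
  have key : ∀ p ∈ movedEdges φ \ movedEdges ψ, ψ p.1 = p.2 ∧ p.1 < p.2 := by
    intro p hp
    simp only [movedEdges, Finset.mem_sdiff, Finset.mem_filter, Finset.mem_univ, true_and,
      not_and, not_not] at hp
    obtain ⟨⟨hlt, hφ⟩, hψ⟩ := hp
    rcases hψ hlt with ⟨h1, h2⟩ | ⟨h1, -⟩
    · refine absurd (Or.inl ?_) hφ
      have hmem : ∀ x, ψ x = x → φ x = x := fun x hx => by
        rwa [← Equiv.Perm.notMem_support, h, Equiv.Perm.notMem_support]
      exact ⟨hmem _ h1, hmem _ h2⟩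
    · exact ⟨h1, hlt⟩
  refine Finset.card_le_card_of_injOn Prod.fst (fun p hp => ?_) fun p hp q hq hpq => ?_
  · obtain ⟨h1, h2⟩ := key p hp
    simpa [h1] using h2.ne'
  · exact Prod.ext hpq (by rw [← (key p hp).1, ← (key q hq).1, hpq])

lemma card_movedEdges_sdiff_union_le {φ ψ : Equiv.Perm (Fin n)} (h : φ.support = ψ.support) :
    #((movedEdges φ \ movedEdges ψ) ∪ (movedEdges ψ \ movedEdges φ)) ≤ 2 * #ψ.support := by
  have h1 := card_movedEdges_sdiff_le h
  have h2 := card_movedEdges_sdiff_le h.symm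
  rw [h] at h2
  exact (Finset.card_union_le _ _).trans (by omega)

/-- The number of permutations with support `D` is at most `|D| ^ |D|`. -/
lemma card_filter_support_eq_le (D : Finset (Fin n)) :
    #{φ : Equiv.Perm (Fin n) | φ.support = D} ≤ #D ^ #D := by
  have hcard : #(Fintype.piFinset fun i => if i ∈ D then D else {i}) = #D ^ #D := by
    rw [Fintype.card_piFinset]
    simp [apply_ite]
  rw [← hcard]
  refine Finset.card_le_card_of_injOn (fun φ i => φ i) (fun φ hφ => ?_)
    fun φ _ ψ _ h => Equiv.ext (congrFun h)
  have hφ : φ.support = D := by simpa using hφ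
  subst hφ
  simp only [Finset.mem_coe, Fintype.mem_piFinset]
  intro i
  split_ifs with hi
  · exact Equiv.Perm.apply_mem_support.2 hi
  · simpa using hi

lemma exp_sum_eq_prod (R : Finset (Fin n × Fin n)) (c : ℝ) (f : GW n) :
    Real.exp (c * ∑ p ∈ R, f p.1 p.2 ^ 2) =
      ∏ i, ∏ j, if (i, j) ∈ R then Real.exp (c * f i j ^ 2) else 1 := by
  rw [Finset.mul_sum, Real.exp_sum, ← Fintype.prod_prod_type (fun p : Fin n × Fin n =>
    if p ∈ R then Real.exp (c * f p.1 p.2 ^ 2) else 1)]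
  simp

lemma exp_sum_sq_stdGaussG {c : ℝ}
    (hc : Integrable (fun x => Real.exp (c * x ^ 2)) (gaussianReal 0 1))
    (R : Finset (Fin n × Fin n)) :
    Integrable (fun f : GW n => Real.exp (c * ∑ p ∈ R, f p.1 p.2 ^ 2)) (stdGaussG n) ∧
      ∫ f, Real.exp (c * ∑ p ∈ R, f p.1 p.2 ^ 2) ∂stdGaussG n =
        (∫ x, Real.exp (c * x ^ 2) ∂gaussianReal 0 1) ^ #R := by
  simp_rw [exp_sum_eq_prod]
  have hint (i j : Fin n) : Integrable
      (fun x : ℝ => if (i, j) ∈ R then Real.exp (c * x ^ 2) else 1) (gaussianReal 0 1) := by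
    split_ifs
    · exact hc
    · exact integrable_const 1
  have hval (i j : Fin n) :
      ∫ x, (if (i, j) ∈ R then Real.exp (c * x ^ 2) else 1) ∂gaussianReal 0 1 =
        if (i, j) ∈ R then ∫ x, Real.exp (c * x ^ 2) ∂gaussianReal 0 1 else 1 := by
    split_ifs <;> simp
  constructor
  · exact Integrable.fintype_prod
      (f := fun i (x : Fin n → ℝ) => ∏ j, if (i, j) ∈ R then Real.exp (c * x j ^ 2) else 1)
      fun i => Integrable.fintype_prod (hint i)
  · unfold stdGaussG
    rw [integral_fintype_prod_eq_prod
      (f := fun i (x : Fin n → ℝ) => ∏ j, if (i, j) ∈ R then Real.exp (c * x j ^ 2) else 1)]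
    have hrow (i : Fin n) :
        ∫ x : Fin n → ℝ, (∏ j, if (i, j) ∈ R then Real.exp (c * x j ^ 2) else 1)
            ∂Measure.pi (fun _ => gaussianReal 0 1) =
          ∏ j, if (i, j) ∈ R then ∫ x, Real.exp (c * x ^ 2) ∂gaussianReal 0 1 else 1 := by
      rw [integral_fintype_prod_eq_prod
        (f := fun j (x : ℝ) => if (i, j) ∈ R then Real.exp (c * x ^ 2) else 1)]
      exact Finset.prod_congr rfl fun j _ => hval i j
    simp_rw [hrow]
    rw [← Fintype.prod_prod_type (fun p : Fin n × Fin n =>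
      if p ∈ R then ∫ x, Real.exp (c * x ^ 2) ∂gaussianReal 0 1 else 1)]
    simp

/-- Chernoff bound for a sum of edge energies. -/
lemma measureReal_sum_edgeEnergy_ge_le {c : ℝ} (hc0 : 0 ≤ c)
    (hc : Integrable (fun x => Real.exp (c * x ^ 2)) (gaussianReal 0 1))
    (R : Finset (Fin n × Fin n)) (t : ℝ) :
    (μ n d).real {ω | t ≤ ∑ p ∈ R, edgeEnergy p ω} ≤
      Real.exp (-c * t) * (∫ x, Real.exp (c * x ^ 2) ∂gaussianReal 0 1) ^ (2 * #R) := by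
  obtain ⟨hi, hv⟩ := exp_sum_sq_stdGaussG hc R
  have hsplit (ω : Samp n d) : Real.exp (c * ∑ p ∈ R, edgeEnergy p ω) =
      Real.exp (c * ∑ p ∈ R, ω.1.1 p.1 p.2 ^ 2) * Real.exp (c * ∑ p ∈ R, ω.1.2 p.1 p.2 ^ 2) := by
    simp only [edgeEnergy, Finset.sum_add_distrib, mul_add, Real.exp_add]
  have hfst : MeasurePreserving Prod.fst (μ n d) ((stdGaussG n).prod (stdGaussG n)) :=
    measurePreserving_fst
  have hprod := hi.mul_prod hi
  have hint : Integrable (fun ω : Samp n d => Real.exp (c * ∑ p ∈ R, edgeEnergy p ω)) (μ n d) := by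
    simp_rw [hsplit]
    exact hfst.integrable_comp_of_integrable hprod
  refine (measure_ge_le_exp_mul_mgf t hc0 hint).trans_eq ?_
  congr 1
  rw [mgf]
  simp_rw [hsplit]
  rw [two_mul, pow_add, ← hv, ← integral_prod_mul, ← hfst.map_eq,
    integral_map hfst.measurable.aemeasurable (hfst.map_eq ▸ hprod.aestronglyMeasurable)]

/-- The deviations of `VGstar` at two permutations with the same support differ by more than `s`
only if the edges of the symmetric difference carry a large energy. -/
lemma abs_sub_deviation_le {ρ : ℝ} (hρ : ρ ∈ Set.Icc (-1 : ℝ) 1) {φ ψ : Equiv.Perm (Fin n)}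
    (h : φ.support = ψ.support) (ω : Samp n d) :
    |(VGstar ρ φ ω - ∫ ω', VGstar ρ φ ω' ∂μ n d) - (VGstar ρ ψ ω - ∫ ω', VGstar ρ ψ ω' ∂μ n d)| ≤
      2 * ∑ p ∈ (movedEdges φ \ movedEdges ψ) ∪ (movedEdges ψ \ movedEdges φ), edgeEnergy p ω +
        8 * #ψ.support := by
  have hcard : ((#((movedEdges φ \ movedEdges ψ) ∪ (movedEdges ψ \ movedEdges φ)) : ℕ) : ℝ) ≤
      2 * #ψ.support := by
    exact_mod_cast card_movedEdges_sdiff_union_le h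
  have hdisj : Disjoint (movedEdges φ \ movedEdges ψ) (movedEdges ψ \ movedEdges φ) :=
    disjoint_sdiff_sdiff
  rw [VGstar_sub_integral hρ, VGstar_sub_integral hρ, ← Finset.sum_sdiff_sub_sum_sdiff]
  calc _ ≤ ∑ p ∈ (movedEdges φ \ movedEdges ψ) ∪ (movedEdges ψ \ movedEdges φ),
        |centeredEdge ρ p ω| := by
        rw [Finset.sum_union hdisj]
        exact (abs_sub _ _).trans
          (add_le_add (Finset.abs_sum_le_sum_abs _ _) (Finset.abs_sum_le_sum_abs _ _))
    _ ≤ ∑ p ∈ (movedEdges φ \ movedEdges ψ) ∪ (movedEdges ψ \ movedEdges φ),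
        (2 * edgeEnergy p ω + 4) := by
        refine Finset.sum_le_sum fun p hp => abs_centeredEdge_le hρ ?_ ω
        rcases Finset.mem_union.1 hp with hp | hp <;>
          exact lt_of_mem_movedEdges (Finset.mem_sdiff.1 hp).1
    _ ≤ _ := by
        rw [Finset.sum_add_distrib, ← Finset.mul_sum, Finset.sum_const, nsmul_eq_mul]
        linarith

/-- Tail bound for the difference of the deviations of `VGstar` at two permutations with the
same support. -/
lemma measure_sub_deviation_le {ρ : ℝ} (hρ : ρ ∈ Set.Icc (-1 : ℝ) 1) {c : ℝ} (hc0 : 0 ≤ c)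
    (hc : Integrable (fun x => Real.exp (c * x ^ 2)) (gaussianReal 0 1))
    {φ ψ : Equiv.Perm (Fin n)} (h : φ.support = ψ.support) (s : ℝ) :
    μ n d {ω | s < |(VGstar ρ φ ω - ∫ ω', VGstar ρ φ ω' ∂μ n d) -
        (VGstar ρ ψ ω - ∫ ω', VGstar ρ ψ ω' ∂μ n d)|} ≤
      ENNReal.ofReal (Real.exp (-c * (s / 2 - 4 * #ψ.support)) *
        (∫ x, Real.exp (c * x ^ 2) ∂gaussianReal 0 1) ^ (4 * #ψ.support)) := by
  set R := (movedEdges φ \ movedEdges ψ) ∪ (movedEdges ψ \ movedEdges φ)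
  have hcard : #R ≤ 2 * #ψ.support := card_movedEdges_sdiff_union_le h
  calc _ ≤ μ n d {ω | s / 2 - 4 * #ψ.support ≤ ∑ p ∈ R, edgeEnergy p ω} := by
        refine measure_mono fun ω hω => ?_
        have := (Set.mem_ofPred_eq ▸ hω : _ < _).trans_le (abs_sub_deviation_le hρ h ω)
        simp only [Set.mem_ofPred_eq]
        linarith
    _ = ENNReal.ofReal ((μ n d).real {ω | s / 2 - 4 * #ψ.support ≤ ∑ p ∈ R, edgeEnergy p ω}) :=
        (ofReal_measureReal (by finiteness)).symm
    _ ≤ _ := by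
        refine ENNReal.ofReal_le_ofReal
          ((measureReal_sum_edgeEnergy_ge_le hc0 hc R _).trans ?_)
        gcongr ?_ * ?_
        exact pow_le_pow_right₀ (one_le_integral_exp_sq hc0 hc) (by omega)

end CGM

open CGM in
/-- **Uniform deviation over permutations with a fixed unfixed-point set (Lemma A.2).**
There are universal constants `C, C' > 0` such that for every `n`, `d`, admissible
correlations `ρ, η`, every set `D ⊆ [n]`, every `π̃` with `D_{π̃} = D` and every
`ε > C|D| log|D|`,
`P(∃ φ with D_φ = D : |V*_G(φ) − E V*_G(φ)| > ε)
  ≤ P(|V*_G(π̃) − E V*_G(π̃)| > ε/2) + exp(−C' ε)`. -/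
theorem uniform_deviation_fixed_support :
    ∃ C > (0 : ℝ), ∃ C' > (0 : ℝ),
      ∀ (n d : ℕ) (ρ η : ℝ), ρ ∈ Set.Icc (-1 : ℝ) 1 → η ∈ Set.Icc (-1 : ℝ) 1 →
      ∀ D : Finset (Fin n), ∀ πt : Equiv.Perm (Fin n), πt.support = D →
      ∀ ε : ℝ, C * D.card * Real.log D.card < ε →
        μ n d {ω | ∃ φ : Equiv.Perm (Fin n), φ.support = D ∧
            ε < |VGstar ρ φ ω - ∫ ω', VGstar ρ φ ω' ∂μ n d|} ≤
          μ n d {ω | ε / 2 < |VGstar ρ πt ω - ∫ ω', VGstar ρ πt ω' ∂μ n d|} +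
            ENNReal.ofReal (Real.exp (-(C' * ε))) := by
  obtain ⟨c, hc0, hc⟩ := IsGaussian.exists_integrable_exp_sq (gaussianReal 0 1)
  simp only [Real.norm_eq_abs, sq_abs] at hc
  set M := ∫ x, Real.exp (c * x ^ 2) ∂gaussianReal 0 1
  have hM : 1 ≤ M := one_le_integral_exp_sq hc0.le hc
  have hL : 0 ≤ Real.log M := Real.log_nonneg hM
  refine ⟨8 * (1 + 8 * Real.log M + 8 * c) / c, by positivity, c / 8, by positivity, ?_⟩
  rintro n d ρ η hρ - D πt rfl ε hε
  set k := #πt.support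
  have hklog : (k : ℝ) ≤ 2 * (k * Real.log k) := by
    rcases Nat.lt_or_ge k 2 with h | h
    · have h1 : k ≠ 1 := πt.card_support_ne_one
      have h0 : k = 0 := by omega
      simp [h0]
    · have h2 : Real.log 2 ≤ Real.log k := Real.log_le_log two_pos (by exact_mod_cast h)
      have := Real.log_two_gt_d9
      nlinarith [(Nat.cast_nonneg k : (0 : ℝ) ≤ k)]
  set dev : Equiv.Perm (Fin n) → Samp n d → ℝ :=
    fun φ ω => VGstar ρ φ ω - ∫ ω', VGstar ρ φ ω' ∂μ n d
  set P : Finset (Equiv.Perm (Fin n)) := {φ | φ.support = πt.support} with hP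
  have hkk : ((k ^ k : ℕ) : ℝ) = Real.exp (k * Real.log k) := by
    rcases Nat.eq_zero_or_pos k with h | h
    · simp [h]
    · rw [Nat.cast_pow, Real.exp_nat_mul, Real.exp_log (by exact_mod_cast h)]
  have hMk : M ^ (4 * k) = Real.exp (4 * k * Real.log M) := by
    rw [show (4 * k * Real.log M : ℝ) = ((4 * k : ℕ) : ℝ) * Real.log M by push_cast; ring,
      Real.exp_nat_mul, Real.exp_log (by linarith)]
  have hbound : ((k ^ k : ℕ) : ℝ) * (Real.exp (-c * (ε / 2 / 2 - 4 * k)) * M ^ (4 * k)) ≤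
      Real.exp (-(c / 8 * ε)) := by
    rw [hkk, hMk, ← Real.exp_add, ← Real.exp_add, Real.exp_le_exp]
    have h1 : 8 * (1 + 8 * Real.log M + 8 * c) * (k * Real.log k) < c * ε := by
      have := mul_lt_mul_of_pos_left hε hc0
      calc _ = c * (8 * (1 + 8 * Real.log M + 8 * c) / c * k * Real.log k) := by field_simp
        _ < _ := this
    have h2 := mul_le_mul_of_nonneg_left hklog hL
    have h3 := mul_le_mul_of_nonneg_left hklog hc0.le
    nlinarith
  calc μ n d {ω | ∃ φ : Equiv.Perm (Fin n), φ.support = πt.support ∧ ε < |dev φ ω|}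
      ≤ μ n d ({ω | ε / 2 < |dev πt ω|} ∪ ⋃ φ ∈ P, {ω | ε / 2 < |dev φ ω - dev πt ω|}) := by
        refine measure_mono ?_
        rintro ω ⟨φ, hφ, hlt⟩
        by_cases h : ε / 2 < |dev πt ω|
        · exact Or.inl h
        · refine Or.inr (Set.mem_biUnion (x := φ) (by simpa [hP] using hφ) ?_)
          have := abs_sub_abs_le_abs_sub (dev φ ω) (dev πt ω)
          simp only [Set.mem_ofPred_eq]
          linarith
    _ ≤ μ n d {ω | ε / 2 < |dev πt ω|} +
          ∑ φ ∈ P, μ n d {ω | ε / 2 < |dev φ ω - dev πt ω|} :=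
        (measure_union_le _ _).trans (by gcongr; exact measure_biUnion_finset_le _ _)
    _ ≤ μ n d {ω | ε / 2 < |dev πt ω|} + ENNReal.ofReal (Real.exp (-(c / 8 * ε))) := by
        gcongr
        calc _ ≤ ∑ φ ∈ P, ENNReal.ofReal (Real.exp (-c * (ε / 2 / 2 - 4 * k)) * M ^ (4 * k)) :=
              Finset.sum_le_sum fun φ hφ =>
                measure_sub_deviation_le hρ hc0.le hc (Finset.mem_filter.1 hφ).2 (ε / 2)
          _ = ENNReal.ofReal (#P * (Real.exp (-c * (ε / 2 / 2 - 4 * k)) * M ^ (4 * k))) := by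
              rw [Finset.sum_const, nsmul_eq_mul, ENNReal.ofReal_mul (Nat.cast_nonneg _),
                ENNReal.ofReal_natCast]
          _ ≤ _ := by
              refine ENNReal.ofReal_le_ofReal (le_trans ?_ hbound)
              gcongr
              exact card_filter_support_eq_le _
end
end

section
/- (Joint Gaussian tail bound, general correlation.) Let (W_1, W_2) = (W_1^{(n)}, W_2^{(n)}) be jointly centered Gaussian with variances 1+b_n^{(1)} and 1+b_n^{(2)}, where b_n^{(1)} = o(1) and b_n^{(2)} = o(1), and with correlation coefficient α_n ∈ [0,1]. Then for any sequence t_n → ∞, P(W_1 > t_n, W_2 > t_n) ≤ (1+o(1)) · (1 + (b_n^{(1)}+b_n^{(2)})/2 + (1+o(1))α_n) / (√(2π) t_n) · exp( − t_n² / (1 + (b_n^{(1)}+b_n^{(2)})/2 + (1+o(1))α_n) ). -/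
open MeasureTheory ProbabilityTheory Real Filter Topology

noncomputable section

/-- the law of a pair of independent standard Gaussians -/
def gauss2 : Measure (ℝ × ℝ) := (gaussianReal 0 1).prod (gaussianReal 0 1)

/-- `W₁ = √(1+b₁) G₁`: a centered Gaussian with variance `1+b₁` -/
def W1 (b1 : ℝ) (p : ℝ × ℝ) : ℝ := Real.sqrt (1 + b1) * p.1

/-- `W₂ = √(1+b₂)(α G₁ + √(1−α²) G₂)`: a centered Gaussian with variance `1+b₂` whose
correlation with `W₁` is `α`; together `(W₁, W₂)` is the generic centered bivariate
Gaussian with variances `1+b₁, 1+b₂` and correlation `α ∈ [0,1]`. -/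
def W2 (b2 α : ℝ) (p : ℝ × ℝ) : ℝ :=
  Real.sqrt (1 + b2) * (α * p.1 + Real.sqrt (1 - α ^ 2) * p.2)

/-- The Mills-ratio upper bound for the tail of a centered Gaussian. -/
theorem gaussianReal_real_Ioi_le {v : NNReal} (hv : v ≠ 0) {s : ℝ} (hs : 0 < s) :
    (gaussianReal 0 v).real (Set.Ioi s) ≤ v / s * gaussianPDFReal 0 v s := by
  have hv' : (0 : ℝ) < v := by positivity
  have hderiv : ∀ x ∈ Set.Ici s, HasDerivAt (fun x => -(v / s) * gaussianPDFReal 0 v x)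
      (x / s * gaussianPDFReal 0 v x) x := by
    intro x _
    unfold gaussianPDFReal
    have h1 : HasDerivAt (fun x : ℝ => -(x - 0) ^ 2 / (2 * v)) (-x / v) x := by
      have := (((hasDerivAt_id x).sub_const (0 : ℝ)).pow 2).neg.div_const (2 * (v : ℝ))
      refine this.congr_deriv ?_
      simp only [id]
      field_simp
      norm_num
      ring
    refine ((h1.exp.const_mul (√(2 * π * v))⁻¹).const_mul (-(v / s))).congr_deriv ?_
    field_simp
  have hnonneg : ∀ x ∈ Set.Ioi s, 0 ≤ x / s * gaussianPDFReal 0 v x := fun x hx =>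
    mul_nonneg (div_nonneg (hs.trans hx).le hs.le) (gaussianPDFReal_nonneg _ _ _)
  have hlim : Tendsto (fun x => -(v / s) * gaussianPDFReal 0 v x) atTop (𝓝 0) := by
    have hsq : Tendsto (fun x : ℝ => (x - 0) ^ 2 / (2 * v)) atTop atTop := by
      simp only [sub_zero]
      exact (tendsto_pow_atTop two_ne_zero).atTop_div_const (by positivity)
    have hexp := tendsto_exp_neg_atTop_nhds_zero.comp hsq
    have := (hexp.const_mul (√(2 * π * v))⁻¹).const_mul (-(v / s))
    simpa [gaussianPDFReal, Function.comp_def, neg_div] using this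
  have hint := integrableOn_Ioi_deriv_of_nonneg' hderiv hnonneg hlim
  have heq := integral_Ioi_of_hasDerivAt_of_nonneg' hderiv hnonneg hlim
  rw [measureReal_def, gaussianReal_apply_eq_integral 0 hv, ENNReal.toReal_ofReal
    (integral_nonneg fun x => gaussianPDFReal_nonneg _ _ _)]
  calc ∫ x in Set.Ioi s, gaussianPDFReal 0 v x
      ≤ ∫ x in Set.Ioi s, x / s * gaussianPDFReal 0 v x := by
        refine setIntegral_mono_on (integrable_gaussianPDFReal 0 v).integrableOn hint
          measurableSet_Ioi fun x hx => ?_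
        exact le_mul_of_one_le_left (gaussianPDFReal_nonneg _ _ _)
          ((one_le_div hs).2 (Set.mem_Ioi.1 hx).le)
    _ = v / s * gaussianPDFReal 0 v s := by rw [heq]; ring

/-- A linear combination of independent standard Gaussians is Gaussian. -/
theorem gauss2_map_linear (x y : ℝ) :
    gauss2.map (fun p => x * p.1 + y * p.2) = gaussianReal 0 (x ^ 2 + y ^ 2).toNNReal := by
  have hindep : IndepFun (fun p : ℝ × ℝ => x * p.1) (fun p => y * p.2) gauss2 :=
    indepFun_prod (measurable_const_mul x) (measurable_const_mul y)
  have hfst : HasLaw (fun p : ℝ × ℝ => p.1) (gaussianReal 0 1) gauss2 :=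
    ⟨by fun_prop, by simp [gauss2, Measure.map_fst_prod]⟩
  have hsnd : HasLaw (fun p : ℝ × ℝ => p.2) (gaussianReal 0 1) gauss2 :=
    ⟨by fun_prop, by simp [gauss2, Measure.map_snd_prod]⟩
  have h := gaussianReal_add_gaussianReal_of_indepFun hindep
    (gaussianReal_const_mul hfst x).map_eq (gaussianReal_const_mul hsnd y).map_eq
  have hvar : (x ^ 2 + y ^ 2).toNNReal =
      NNReal.mk (x ^ 2) (sq_nonneg x) * 1 + NNReal.mk (y ^ 2) (sq_nonneg y) * 1 := by
    apply NNReal.eq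
    simp [add_nonneg (sq_nonneg x) (sq_nonneg y)]
  rw [hvar, show (0 : ℝ) = x * 0 + y * 0 by ring]
  exact h

instance : IsProbabilityMeasure gauss2 := by
  unfold gauss2
  infer_instance

theorem W1_add_W2_variance {b1 b2 α : ℝ} (h1 : 0 ≤ 1 + b1) (h2 : 0 ≤ 1 + b2)
    (hα : α ∈ Set.Icc (0 : ℝ) 1) :
    (√(1 + b1) + √(1 + b2) * α) ^ 2 + (√(1 + b2) * √(1 - α ^ 2)) ^ 2 =
      2 * (1 + (b1 + b2) / 2 + √((1 + b1) * (1 + b2)) * α) := by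
  have hα' : 0 ≤ 1 - α ^ 2 := by nlinarith [hα.1, hα.2]
  rw [sqrt_mul h1, mul_pow, sq_sqrt hα', add_sq, mul_pow, sq_sqrt h1, sq_sqrt h2]
  ring

/-- The joint upper tail is at most the tail of `W₁ + W₂` at `2t`. -/
theorem gauss2_joint_tail_le {b1 b2 α t : ℝ} (h1 : 0 ≤ 1 + b1) (h2 : 0 ≤ 1 + b2)
    (hα : α ∈ Set.Icc (0 : ℝ) 1) (ht : 0 < t)
    (hD : 1 / 2 ≤ 1 + (b1 + b2) / 2 + √((1 + b1) * (1 + b2)) * α) :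
    (gauss2 {p | t < W1 b1 p ∧ t < W2 b2 α p}).toReal ≤
      (1 + (b1 + b2) / 2 + √((1 + b1) * (1 + b2)) * α) / (√(2 * π) * t) *
        exp (-t ^ 2 / (1 + (b1 + b2) / 2 + √((1 + b1) * (1 + b2)) * α)) := by
  have hvar := W1_add_W2_variance h1 h2 hα
  set D := 1 + (b1 + b2) / 2 + √((1 + b1) * (1 + b2)) * α
  have hD0 : 0 < D := by linarith
  have hmap := gauss2_map_linear (√(1 + b1) + √(1 + b2) * α) (√(1 + b2) * √(1 - α ^ 2))
  rw [hvar] at hmap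
  have hcoe : (((2 * D).toNNReal : NNReal) : ℝ) = 2 * D := coe_toNNReal _ (by linarith)
  have hroot : √D ≤ √2 * D := by
    rw [sqrt_le_left (by positivity), mul_pow, sq_sqrt (by norm_num)]
    nlinarith
  calc (gauss2 {p | t < W1 b1 p ∧ t < W2 b2 α p}).toReal
      ≤ gauss2.real ((fun p => (√(1 + b1) + √(1 + b2) * α) * p.1 +
          (√(1 + b2) * √(1 - α ^ 2)) * p.2) ⁻¹' Set.Ioi (2 * t)) := by
        refine measureReal_mono fun p hp => ?_
        simp only [Set.mem_ofPred_eq, W1, W2] at hp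
        simp only [Set.mem_preimage, Set.mem_Ioi]
        linarith [hp.1, hp.2]
    _ = (gaussianReal 0 (2 * D).toNNReal).real (Set.Ioi (2 * t)) := by
        rw [← hmap, map_measureReal_apply (by fun_prop) measurableSet_Ioi]
    _ ≤ (2 * D) / (2 * t) * gaussianPDFReal 0 (2 * D).toNNReal (2 * t) := by
        have := gaussianReal_real_Ioi_le (v := (2 * D).toNNReal)
          (by simpa using hD0) (show 0 < 2 * t by linarith)
        rwa [hcoe] at this
    _ = √D / √2 / (√(2 * π) * t) * exp (-t ^ 2 / D) := by
        rw [gaussianPDFReal, hcoe]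
        have hexp : -(2 * t - 0) ^ 2 / (2 * (2 * D)) = -t ^ 2 / D := by field_simp; ring
        rw [hexp, sqrt_mul (by positivity), sqrt_mul zero_le_two D]
        have : √D ≠ 0 := by positivity
        nth_rw 1 [← sq_sqrt hD0.le]
        field_simp
    _ ≤ D / (√(2 * π) * t) * exp (-t ^ 2 / D) := by
        gcongr
        rw [div_le_iff₀ (by positivity)]
        linarith

/-- **Joint Gaussian tail bound, general correlation (Lemma C.3 (i)).**  If
`(W₁, W₂) = (W₁⁽ⁿ⁾, W₂⁽ⁿ⁾)` is jointly centered Gaussian with variances `1+b₁ₙ`, `1+b₂ₙ`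
(`b₁ₙ, b₂ₙ = o(1)`) and correlation `αₙ ∈ [0,1]`, then for any sequence `tₙ → ∞`,
`P(W₁ > tₙ, W₂ > tₙ) ≤ (1+o(1)) (1 + (b₁ₙ+b₂ₙ)/2 + (1+o(1))αₙ) / (√(2π) tₙ)
  · exp(−tₙ² / (1 + (b₁ₙ+b₂ₙ)/2 + (1+o(1))αₙ))`. -/
theorem joint_gaussian_tail_general (b1 b2 α t : ℕ → ℝ)
    (hb1 : Tendsto b1 atTop (𝓝 0)) (hb2 : Tendsto b2 atTop (𝓝 0))
    (hb1' : ∀ n, 0 ≤ 1 + b1 n) (hb2' : ∀ n, 0 ≤ 1 + b2 n)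
    (hα : ∀ n, α n ∈ Set.Icc (0 : ℝ) 1)
    (ht : Tendsto t atTop atTop) :
    ∃ c1 c2 c3 : ℕ → ℝ,
      Tendsto c1 atTop (𝓝 0) ∧ Tendsto c2 atTop (𝓝 0) ∧ Tendsto c3 atTop (𝓝 0) ∧
      ∀ᶠ n : ℕ in atTop,
        (gauss2 {p | t n < W1 (b1 n) p ∧ t n < W2 (b2 n) (α n) p}).toReal ≤
          (1 + c1 n) * (1 + (b1 n + b2 n) / 2 + (1 + c2 n) * α n) /
              (Real.sqrt (2 * Real.pi) * t n) *
            Real.exp (-(t n) ^ 2 / (1 + (b1 n + b2 n) / 2 + (1 + c3 n) * α n)) := by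
  have hc : Tendsto (fun n => √((1 + b1 n) * (1 + b2 n)) - 1) atTop (𝓝 0) := by
    simpa using (((hb1.const_add 1).mul (hb2.const_add 1)).sqrt).sub_const 1
  have hb : Tendsto (fun n => 1 + (b1 n + b2 n) / 2) atTop (𝓝 1) := by
    simpa using ((hb1.add hb2).div_const 2).const_add 1
  refine ⟨fun _ => 0, _, _, tendsto_const_nhds, hc, hc, ?_⟩
  filter_upwards [ht.eventually_gt_atTop 0,
    hb.eventually_const_le (show (1 / 2 : ℝ) < 1 by norm_num)] with n hn hbn
  have hD : 1 / 2 ≤ 1 + (b1 n + b2 n) / 2 + √((1 + b1 n) * (1 + b2 n)) * α n := by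
    have := mul_nonneg (sqrt_nonneg ((1 + b1 n) * (1 + b2 n))) (hα n).1
    linarith
  simpa using gauss2_joint_tail_le (hb1' n) (hb2' n) (hα n) hn hD
end
end

section
/- (Counting pairs of derangements with many agreements.) There exists a constant C > 0 such that for all n ≥ 1 and all m ∈ {0,1,…,n}, the number of ordered pairs (π, π') of derangements of [n] with |{i ∈ [n] : π(i) = π'(i)}| > m is at most C (n!)² / (m+1)!. -/
open Finset

/-- The permutations fixing every point of `s` are counted by `(card α - #s)!`. -/
theorem card_perm_fixing {α : Type*} [Fintype α] [DecidableEq α] (s : Finset α) :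
    #{σ : Equiv.Perm α | ∀ a ∈ s, σ a = a} = (Fintype.card α - #s).factorial := by
  have e := Fintype.card_congr (Equiv.Perm.subtypeEquivSubtypePerm fun a => a ∉ s)
  rw [Fintype.card_perm, Fintype.card_subtype_compl, Fintype.card_coe] at e
  rw [e, Fintype.card_subtype]
  simp only [not_not]

theorem card_perm_many_fixed_le {α : Type*} [Fintype α] [DecidableEq α] (k : ℕ) :
    #{σ : Equiv.Perm α | k ≤ #{a | σ a = a}} ≤
      (Fintype.card α).choose k * (Fintype.card α - k).factorial := by
  have hsub : ({σ : Equiv.Perm α | k ≤ #{a | σ a = a}} : Finset _) ⊆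
      (powersetCard k (univ : Finset α)).biUnion fun s => {σ | ∀ a ∈ s, σ a = a} := by
    intro σ hσ
    obtain ⟨s, hs, hcard⟩ := exists_subset_card_eq (mem_filter.mp hσ).2
    simp only [mem_biUnion, mem_powersetCard, mem_filter, mem_univ, true_and]
    exact ⟨s, ⟨subset_univ s, hcard⟩, fun a ha => (mem_filter.mp (hs ha)).2⟩
  refine (card_le_card hsub).trans ((card_biUnion_le_card_mul _ _ (Fintype.card α - k).factorial ?_).trans_eq ?_)
  · intro s hs
    rw [card_perm_fixing, (mem_powersetCard.mp hs).2]
  · rw [card_powersetCard, card_univ]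

theorem card_perm_pairs_many_agreements_le {α : Type*} [Fintype α] [DecidableEq α] (k : ℕ) :
    #{q : Equiv.Perm α × Equiv.Perm α | k ≤ #{a | q.1 a = q.2 a}} ≤
      (Fintype.card α).factorial *
        ((Fintype.card α).choose k * (Fintype.card α - k).factorial) := by
  calc
    _ ≤ #((univ : Finset (Equiv.Perm α)) ×ˢ
          ({σ : Equiv.Perm α | k ≤ #{a | σ a = a}} : Finset _)) := by
      refine card_le_card_of_injOn (fun q => (q.1, q.1⁻¹ * q.2)) ?_ ?_
      · intro q hq
        simpa [Equiv.symm_apply_eq, eq_comm (a := q.1 _)] using hq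
      · rintro ⟨a, b⟩ - ⟨c, d⟩ - h
        simp only [Prod.mk.injEq] at h
        obtain ⟨rfl, h⟩ := h
        rw [mul_left_cancel h]
    _ ≤ _ := by
      rw [card_product, card_univ, Fintype.card_perm]
      exact Nat.mul_le_mul_left _ (card_perm_many_fixed_le k)

/-- **Counting pairs of derangements with many agreements (consequence of Lemma C.6).**
There is a constant `C > 0` such that for all `n ≥ 1` and all `m ∈ {0,…,n}`, the number
of ordered pairs `(φ, φ')` of derangements of `[n]` agreeing in more than `m` points is at
most `C (n!)² / (m+1)!`. -/
theorem count_derangement_pairs_with_many_agreements :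
    ∃ C > (0 : ℝ), ∀ n : ℕ, 1 ≤ n → ∀ m : ℕ, m ≤ n →
      ((Finset.univ.filter fun q : Equiv.Perm (Fin n) × Equiv.Perm (Fin n) =>
          (∀ i, q.1 i ≠ i) ∧ (∀ i, q.2 i ≠ i) ∧
            m < (Finset.univ.filter fun i => q.1 i = q.2 i).card).card : ℝ) ≤
        C * (n.factorial : ℝ) ^ 2 / ((m + 1).factorial : ℝ) := by
  refine ⟨1, one_pos, fun n _ m _ => ?_⟩
  rw [one_mul, le_div_iff₀ (by positivity)]
  norm_cast
  have hle := (card_le_card (monotone_filter_right univ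
    (fun (q : Equiv.Perm (Fin n) × Equiv.Perm (Fin n)) _
      (h : (∀ i, q.1 i ≠ i) ∧ (∀ i, q.2 i ≠ i) ∧ m < #{i | q.1 i = q.2 i}) => h.2.2))).trans
    (card_perm_pairs_many_agreements_le (α := Fin n) (m + 1))
  rw [Fintype.card_fin] at hle
  refine (Nat.mul_le_mul_right _ hle).trans ?_
  rcases le_or_gt (m + 1) n with hmn | hmn
  · rw [sq, mul_assoc, mul_right_comm (n.choose _), Nat.choose_mul_factorial_mul_factorial hmn]
  · simp [Nat.choose_eq_zero_of_lt hmn]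
end
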